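/- arXiv:1106.5517 — 7 statements merged into one kernel-verified Lean document; each statement's English description precedes it below -/
import Mathlib

section
/- Let F be an algebraically closed field and let F₁ and F₂ be field extensions of F. Then the tensor product F₁ ⊗_F F₂ is an integral domain (it is a nonzero commutative ring with no zero divisors). -/
open scoped TensorProduct

/-- A nontrivial finite type algebra over an algebraically closed field has a rational point. -/
lemma exists_point (F A : Type*) [Field F] [IsAlgClosed F] [CommRing A] [Nontrivial A]
    [Algebra F A] [Algebra.FiniteType F A] : Nonempty (A →ₐ[F] F) := by
  obtain ⟨m, hm⟩ := Ideal.exists_maximal A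
  letI : Field (A ⧸ m) := Ideal.Quotient.field m
  haveI : Algebra.FiniteType F (A ⧸ m) :=
    Algebra.FiniteType.of_surjective (Ideal.Quotient.mkₐ F m) (Ideal.Quotient.mkₐ_surjective F m)
  haveI : Module.Finite F (A ⧸ m) := finite_of_finite_type_of_isJacobsonRing F (A ⧸ m)
  have hb : Function.Bijective (algebraMap F (A ⧸ m)) :=
    IsAlgClosed.algebraMap_bijective_of_isIntegral
  let e : F ≃ₐ[F] (A ⧸ m) := AlgEquiv.ofBijective (Algebra.ofId F (A ⧸ m)) hb
  exact ⟨(e.symm : (A ⧸ m) →ₐ[F] F).comp (Ideal.Quotient.mkₐ F m)⟩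

/-- Lift an element of the tensor product along a subalgebra containing its coordinates, so that
its specialization at a point not killing some coordinate is nonzero. -/
lemma exists_lift {F F₁ F₂ ι : Type*} [Field F] [Field F₁] [Field F₂]
    [Algebra F F₁] [Algebra F F₂] (b : Module.Basis ι F F₂) (A : Subalgebra F F₁)
    (φ : A →ₐ[F] F) (x : F₁ ⊗[F] F₂)
    (hA : ∀ i, (b.baseChange F₁).repr x i ∈ A) (i₀ : ι)
    (h : φ ⟨_, hA i₀⟩ ≠ 0) :
    ∃ x' : A ⊗[F] F₂, Algebra.TensorProduct.map A.val (AlgHom.id F F₂) x' = x ∧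
      Algebra.TensorProduct.productMap ((Algebra.ofId F F₂).comp φ) (AlgHom.id F F₂) x' ≠ 0 := by
  classical
  set c := (b.baseChange F₁).repr x with hc
  refine ⟨∑ i ∈ c.support, (⟨c i, hA i⟩ : A) ⊗ₜ[F] b i, ?_, ?_⟩
  · rw [map_sum]
    conv_rhs => rw [← (b.baseChange F₁).linearCombination_repr x]
    rw [Finsupp.linearCombination_apply, Finsupp.sum]
    refine Finset.sum_congr rfl fun i _ => ?_
    simp [TensorProduct.smul_tmul', hc]
  · rw [map_sum]
    intro h0
    have h1 : ∑ i ∈ c.support, φ ⟨c i, hA i⟩ • b i = 0 := by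
      rw [← h0]
      refine Finset.sum_congr rfl fun i _ => ?_
      simp [Algebra.smul_def, Algebra.ofId_apply]
    refine h (linearIndependent_iff'.1 b.linearIndependent _ _ h1 i₀ ?_)
    rw [Finsupp.mem_support_iff]
    intro h2
    apply h
    have : (⟨c i₀, hA i₀⟩ : A) = 0 := Subtype.ext h2
    rw [this, map_zero]

/-- Let `F` be an algebraically closed field and let `F₁` and `F₂` be field extensions of `F`.
Then the tensor product `F₁ ⊗[F] F₂` is an integral domain. -/
theorem tensorProduct_of_field_extensions_isDomain
    (F F₁ F₂ : Type*) [Field F] [IsAlgClosed F] [Field F₁] [Field F₂]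
    [Algebra F F₁] [Algebra F F₂] :
    IsDomain (F₁ ⊗[F] F₂) := by
  classical
  haveI : NoZeroDivisors (F₁ ⊗[F] F₂) := by
    refine ⟨fun {x y} hxy => ?_⟩
    by_contra! hne
    obtain ⟨hx, hy⟩ := hne
    let b := Module.Basis.ofVectorSpace F F₂
    let B := b.baseChange F₁
    obtain ⟨i, hi⟩ : ∃ i, B.repr x i ≠ 0 := by
      by_contra! h
      exact hx (B.repr.map_eq_zero_iff.1 (Finsupp.ext h))
    obtain ⟨j, hj⟩ : ∃ i, B.repr y i ≠ 0 := by
      by_contra! h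
      exact hy (B.repr.map_eq_zero_iff.1 (Finsupp.ext h))
    let s : Finset F₁ := (B.repr x).support.image (B.repr x) ∪ (B.repr y).support.image (B.repr y)
      ∪ {(B.repr x i)⁻¹, (B.repr y j)⁻¹}
    let A := Algebra.adjoin F (s : Set F₁)
    have hsA : ∀ a ∈ s, a ∈ A := fun a ha => Algebra.subset_adjoin ha
    haveI : Algebra.FiniteType F A := (Subalgebra.fg_iff_finiteType A).1 ⟨s, rfl⟩
    have hAx : ∀ k, B.repr x k ∈ A := fun k => by
      by_cases hk : B.repr x k = 0
      · rw [hk]; exact A.zero_mem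
      · exact hsA _ (Finset.mem_union_left _ (Finset.mem_union_left _
          (Finset.mem_image_of_mem _ (Finsupp.mem_support_iff.2 hk))))
    have hAy : ∀ k, B.repr y k ∈ A := fun k => by
      by_cases hk : B.repr y k = 0
      · rw [hk]; exact A.zero_mem
      · exact hsA _ (Finset.mem_union_left _ (Finset.mem_union_right _
          (Finset.mem_image_of_mem _ (Finsupp.mem_support_iff.2 hk))))
    have hix : (B.repr x i)⁻¹ ∈ A := hsA _ (Finset.mem_union_right _ (by simp))
    have hjy : (B.repr y j)⁻¹ ∈ A := hsA _ (Finset.mem_union_right _ (by simp))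
    obtain ⟨φ⟩ := exists_point F A
    have key : ∀ (a : F₁) (ha : a ∈ A) (_ : a⁻¹ ∈ A), a ≠ 0 → φ ⟨a, ha⟩ ≠ 0 := by
      intro a ha ha' h0 h
      have h1 : (⟨a, ha⟩ : A) * ⟨a⁻¹, ha'⟩ = 1 := Subtype.ext (mul_inv_cancel₀ h0)
      have h2 := congrArg φ h1
      rw [map_mul, h, zero_mul, map_one] at h2
      exact zero_ne_one h2
    obtain ⟨x', hx', hx0⟩ := exists_lift b A φ x hAx i (key _ _ hix hi)
    obtain ⟨y', hy', hy0⟩ := exists_lift b A φ y hAy j (key _ _ hjy hj)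
    have hinj : Function.Injective (Algebra.TensorProduct.map A.val (AlgHom.id F F₂)) :=
      Module.Flat.rTensor_preserves_injective_linearMap (M := F₂) A.val.toLinearMap
        Subtype.val_injective
    have h0 : x' * y' = 0 := hinj (by rw [map_mul, hx', hy', hxy, map_zero])
    have h1 := congrArg
      (Algebra.TensorProduct.productMap ((Algebra.ofId F F₂).comp φ) (AlgHom.id F F₂)) h0
    rw [map_mul, map_zero] at h1
    exact (mul_ne_zero hx0 hy0) h1
  exact NoZeroDivisors.to_isDomain _
end

section
/- Let F be an algebraically closed field, let F₁ be a field extension of F, and let D₂ be a division ring equipped with an F-algebra structure (so F lies in the center of D₂; D₂ need not be finite-dimensional over its center). Then F₁ ⊗_F D₂ has no zero divisors: if α₁, α₂ ∈ F₁ ⊗_F D₂ are both nonzero, then α₁·α₂ ≠ 0. -/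
open scoped TensorProduct

theorem tpaux_lift (F F₁ D₂ : Type*) [Field F] [Field F₁] [Algebra F F₁]
    [DivisionRing D₂] [Algebra F D₂] (α : F₁ ⊗[F] D₂) :
    ∃ S : Set F₁, S.Finite ∧ ∀ A : Subalgebra F F₁, S ⊆ A →
      ∃ a : A ⊗[F] D₂, Algebra.TensorProduct.map A.val (AlgHom.id F D₂) a = α := by
  induction α using TensorProduct.induction_on with
  | zero => exact ⟨∅, Set.finite_empty, fun A _ => ⟨0, map_zero _⟩⟩
  | tmul x y =>
    refine ⟨{x}, Set.finite_singleton x, fun A h => ⟨(⟨x, h rfl⟩ : A) ⊗ₜ y, ?_⟩⟩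
    simp
  | add x y hx hy =>
    obtain ⟨S, hS, h1⟩ := hx
    obtain ⟨T, hT, h2⟩ := hy
    refine ⟨S ∪ T, hS.union hT, fun A h => ?_⟩
    obtain ⟨a, ha⟩ := h1 A (Set.subset_union_left.trans h)
    obtain ⟨b, hb⟩ := h2 A (Set.subset_union_right.trans h)
    exact ⟨a + b, by rw [map_add, ha, hb]⟩

theorem tpaux_coord {F A B D ι : Type*} [DecidableEq ι] [Field F] [CommRing A] [Algebra F A] [CommRing B]
    [Algebra F B] [DivisionRing D] [Algebra F D] (b : Module.Basis ι F D) (g : A →ₐ[F] B)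
    (i : ι) (a : A ⊗[F] D) :
    TensorProduct.equivFinsuppOfBasisRight b
      (Algebra.TensorProduct.map g (AlgHom.id F D) a) i =
      g (TensorProduct.equivFinsuppOfBasisRight b a i) := by
  induction a using TensorProduct.induction_on with
  | zero => simp
  | tmul x y => simp [TensorProduct.equivFinsuppOfBasisRight_apply_tmul_apply]
  | add x y hx hy => simp only [map_add, Finsupp.add_apply, hx, hy]

theorem tpaux_point {F A : Type*} [Field F] [IsAlgClosed F] [CommRing A] [Nontrivial A]
    [Algebra F A] [Algebra.FiniteType F A] : Nonempty (A →ₐ[F] F) := by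
  obtain ⟨m, hm⟩ := Ideal.exists_maximal A
  letI : Field (A ⧸ m) := Ideal.Quotient.field m
  have : Algebra.FiniteType F (A ⧸ m) :=
    Algebra.FiniteType.of_surjective (Ideal.Quotient.mkₐ F m) (Ideal.Quotient.mkₐ_surjective F m)
  have : Module.Finite F (A ⧸ m) := finite_of_finite_type_of_isJacobsonRing F (A ⧸ m)
  exact ⟨(IsAlgClosed.lift : (A ⧸ m) →ₐ[F] F).comp (Ideal.Quotient.mkₐ F m)⟩

/-- Let `F` be an algebraically closed field, `F₁` a field extension of `F`, and `D₂` a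
division ring which is an `F`-algebra.  Then `F₁ ⊗[F] D₂` has no zero divisors. -/
theorem tensorProduct_field_divisionRing_no_zero_divisors
    (F F₁ D₂ : Type*) [Field F] [IsAlgClosed F] [Field F₁] [Algebra F F₁]
    [DivisionRing D₂] [Algebra F D₂] :
    ∀ α₁ α₂ : F₁ ⊗[F] D₂, α₁ ≠ 0 → α₂ ≠ 0 → α₁ * α₂ ≠ 0 := by
  classical
  intro α₁ α₂ h₁ h₂ h
  let b := Module.Basis.ofVectorSpace F D₂
  have key : ∀ α : F₁ ⊗[F] D₂, α ≠ 0 →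
      ∃ i, TensorProduct.equivFinsuppOfBasisRight b α i ≠ 0 := by
    intro α hα
    by_contra! hc
    exact hα ((TensorProduct.equivFinsuppOfBasisRight b).map_eq_zero_iff.1 (Finsupp.ext hc))
  obtain ⟨i, hi⟩ := key α₁ h₁
  obtain ⟨j, hj⟩ := key α₂ h₂
  obtain ⟨S, hS, lS⟩ := tpaux_lift F F₁ D₂ α₁
  obtain ⟨T, hT, lT⟩ := tpaux_lift F F₁ D₂ α₂
  set c := TensorProduct.equivFinsuppOfBasisRight b α₁ i with hc
  set d := TensorProduct.equivFinsuppOfBasisRight b α₂ j with hd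
  let U : Set F₁ := (S ∪ T) ∪ {c⁻¹, d⁻¹}
  have hU : U.Finite := (hS.union hT).union (Set.toFinite _)
  let A : Subalgebra F F₁ := Algebra.adjoin F U
  have hUA : U ⊆ A := Algebra.subset_adjoin
  have : Algebra.FiniteType F A :=
    (Subalgebra.fg_iff_finiteType A).1 (Subalgebra.fg_def.2 ⟨U, hU, rfl⟩)
  obtain ⟨φ⟩ := tpaux_point (F := F) (A := A)
  obtain ⟨x, hx⟩ := lS A (fun s hs => hUA (Or.inl (Or.inl hs)))
  obtain ⟨y, hy⟩ := lT A (fun s hs => hUA (Or.inl (Or.inr hs)))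
  have hxy : x * y = 0 := by
    have inj : Function.Injective (Algebra.TensorProduct.map A.val (AlgHom.id F D₂)) :=
      Module.Flat.rTensor_preserves_injective_linearMap (M := D₂) A.val.toLinearMap
        Subtype.val_injective
    apply inj
    rw [map_mul, hx, hy, h, map_zero]
  have nz : ∀ (z : A ⊗[F] D₂) (k) (e : F₁), e ≠ 0 → e⁻¹ ∈ A →
      TensorProduct.equivFinsuppOfBasisRight b
        (Algebra.TensorProduct.map A.val (AlgHom.id F D₂) z) k = e →
      Algebra.TensorProduct.map φ (AlgHom.id F D₂) z ≠ 0 := by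
    intro z k e he hinv hz h0
    have h3 := tpaux_coord b φ k z
    rw [h0, map_zero, Finsupp.zero_apply] at h3
    rw [tpaux_coord] at hz
    have h4 : TensorProduct.equivFinsuppOfBasisRight b z k * (⟨e⁻¹, hinv⟩ : A) = 1 := by
      apply Subtype.ext
      change A.val _ * e⁻¹ = 1
      rw [hz, mul_inv_cancel₀ he]
    have h5 := congrArg φ h4
    rw [map_mul, ← h3, zero_mul, map_one] at h5
    exact zero_ne_one h5
  have n1 := nz x i c hi (hUA (Or.inr (Or.inl rfl))) (by rw [hx])
  have n2 := nz y j d hj (hUA (Or.inr (Or.inr rfl))) (by rw [hy])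
  have h6 := congrArg (fun z => Algebra.TensorProduct.lid F D₂
    (Algebra.TensorProduct.map φ (AlgHom.id F D₂) z)) hxy
  simp only [map_mul, map_zero] at h6
  rcases mul_eq_zero.1 h6 with h7 | h7
  · exact n1 ((Algebra.TensorProduct.lid F D₂).map_eq_zero_iff.1 h7)
  · exact n2 ((Algebra.TensorProduct.lid F D₂).map_eq_zero_iff.1 h7)
end

section
/- Let F be an algebraically closed field and let D₁ be a division ring equipped with an F-algebra structure. Suppose there exist a subring S ⊆ D₁ containing the image of F and an element π ∈ S with π ≠ 0 and π not a unit of S, such that: (i) πS = Sπ; and (ii) every nonzero element of D₁ can be written as u·πⁿ for some unit u of S and some integer n. Let D₂ be a division ring equipped with an F-algebra structure. If D₁ ⊗_F D₂ has a zero divisor (i.e. there exist nonzero α₁, α₂ ∈ D₁ ⊗_F D₂ with α₁·α₂ = 0), then the ring (S/πS) ⊗_F D₂ also has a zero divisor. -/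
open scoped TensorProduct

section aux

variable {F D₁ : Type*} [Field F] [DivisionRing D₁] [Algebra F D₁]

/-- Finite sets of elements of a division ring have a least element for left divisibility. -/
theorem aux_min_left (S : Subalgebra F D₁) (hS : ∀ d : D₁, d ≠ 0 → d ∈ S ∨ d⁻¹ ∈ S)
    {ι : Type*} (f : ι → D₁) (t : Finset ι) (ht : t.Nonempty) (hf : ∀ i ∈ t, f i ≠ 0) :
    ∃ i ∈ t, ∀ j ∈ t, (f i)⁻¹ * f j ∈ S := by
  classical
  induction ht using Finset.Nonempty.cons_induction with
  | singleton a =>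
    refine ⟨a, by simp, fun j hj => ?_⟩
    rw [Finset.mem_singleton.1 hj, inv_mul_cancel₀ (hf a (by simp))]
    exact S.one_mem
  | cons a s ha hs ih =>
    obtain ⟨i, hi, hij⟩ := ih (fun i hi => hf i (by simp [hi]))
    have hfa : f a ≠ 0 := hf a (by simp)
    have hfi : f i ≠ 0 := hf i (by simp [hi])
    rcases hS ((f i)⁻¹ * f a) (mul_ne_zero (inv_ne_zero hfi) hfa) with h | h
    · refine ⟨i, by simp [hi], fun j hj => ?_⟩
      rcases Finset.mem_cons.1 hj with rfl | hj
      · exact h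
      · exact hij j hj
    · refine ⟨a, by simp, fun j hj => ?_⟩
      rcases Finset.mem_cons.1 hj with rfl | hj
      · rw [inv_mul_cancel₀ hfa]; exact S.one_mem
      · have := S.mul_mem h (hij j hj)
        rwa [mul_inv_rev, inv_inv, mul_assoc, mul_inv_cancel_left₀ hfi] at this

/-- Finite sets of elements of a division ring have a least element for right divisibility. -/
theorem aux_min_right (S : Subalgebra F D₁) (hS : ∀ d : D₁, d ≠ 0 → d ∈ S ∨ d⁻¹ ∈ S)
    {ι : Type*} (f : ι → D₁) (t : Finset ι) (ht : t.Nonempty) (hf : ∀ i ∈ t, f i ≠ 0) :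
    ∃ i ∈ t, ∀ j ∈ t, f j * (f i)⁻¹ ∈ S := by
  classical
  induction ht using Finset.Nonempty.cons_induction with
  | singleton a =>
    refine ⟨a, by simp, fun j hj => ?_⟩
    rw [Finset.mem_singleton.1 hj, mul_inv_cancel₀ (hf a (by simp))]
    exact S.one_mem
  | cons a s ha hs ih =>
    obtain ⟨i, hi, hij⟩ := ih (fun i hi => hf i (by simp [hi]))
    have hfa : f a ≠ 0 := hf a (by simp)
    have hfi : f i ≠ 0 := hf i (by simp [hi])
    rcases hS (f a * (f i)⁻¹) (mul_ne_zero hfa (inv_ne_zero hfi)) with h | h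
    · refine ⟨i, by simp [hi], fun j hj => ?_⟩
      rcases Finset.mem_cons.1 hj with rfl | hj
      · exact h
      · exact hij j hj
    · refine ⟨a, by simp, fun j hj => ?_⟩
      rcases Finset.mem_cons.1 hj with rfl | hj
      · rw [mul_inv_cancel₀ hfa]; exact S.one_mem
      · have := S.mul_mem (hij j hj) h
        rwa [mul_inv_rev, inv_inv, mul_assoc, inv_mul_cancel_left₀ hfi] at this

variable {D₂ : Type*} [DivisionRing D₂] [Algebra F D₂]

theorem aux_repr_mul {ι : Type*} (b : Module.Basis ι F D₂) (α : D₁ ⊗[F] D₂) (c : D₁) (i : ι) :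
    (Algebra.TensorProduct.basis D₁ b).repr (α * (c ⊗ₜ 1)) i
      = (Algebra.TensorProduct.basis D₁ b).repr α i * c := by
  induction α with
  | zero => simp
  | add x y hx hy => simp [add_mul, hx, hy]
  | tmul x y => simp [Algebra.TensorProduct.basis_repr_tmul, mul_assoc, Algebra.commutes]

theorem aux_mul_repr {ι : Type*} (b : Module.Basis ι F D₂) (α : D₁ ⊗[F] D₂) (c : D₁) (i : ι) :
    (Algebra.TensorProduct.basis D₁ b).repr ((c ⊗ₜ 1) * α) i
      = c * (Algebra.TensorProduct.basis D₁ b).repr α i := by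
  induction α with
  | zero => simp
  | add x y hx hy => simp [mul_add, hx, hy]
  | tmul x y => simp [Algebra.TensorProduct.basis_repr_tmul, mul_assoc]

theorem aux_lift {ι : Type*} (b : Module.Basis ι F D₂) (S : Subalgebra F D₁)
    {Q : Type*} [Ring Q] [Algebra F Q] [Nontrivial Q] (q : S →ₐ[F] Q) (α : D₁ ⊗[F] D₂)
    (hα : ∀ i, (Algebra.TensorProduct.basis D₁ b).repr α i ∈ S)
    (i₀ : ι) (hi₀ : (Algebra.TensorProduct.basis D₁ b).repr α i₀ = 1) :
    ∃ γ : S ⊗[F] D₂, Algebra.TensorProduct.map S.val (AlgHom.id F D₂) γ = α ∧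
      Algebra.TensorProduct.map q (AlgHom.id F D₂) γ ≠ 0 := by
  classical
  set r := (Algebra.TensorProduct.basis D₁ b).repr α with hr
  refine ⟨∑ i ∈ r.support, (⟨r i, hα i⟩ : S) ⊗ₜ b i, ?_, ?_⟩
  · rw [map_sum]
    conv_rhs => rw [← (Algebra.TensorProduct.basis D₁ b).linearCombination_repr α, ← hr,
      Finsupp.linearCombination_apply, Finsupp.sum]
    refine Finset.sum_congr rfl fun i _ => ?_
    simp [TensorProduct.smul_tmul']
  · intro h0
    have h1 := congrArg (fun x => (Algebra.TensorProduct.basis Q b).repr x i₀) h0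
    have h2 : i₀ ∈ r.support := by simp [hi₀]
    have h3 : (⟨r i₀, hα i₀⟩ : S) = 1 := Subtype.ext hi₀
    simp only [map_sum, Algebra.TensorProduct.map_tmul, AlgHom.id_apply,
      Finsupp.finsetSum_apply, Algebra.TensorProduct.basis_repr_tmul, map_zero] at h1
    rw [Finset.sum_eq_single_of_mem i₀ h2] at h1
    · simp [h3] at h1
    · intro j _ hj
      simp [Finsupp.single_apply, hj]

theorem aux_nontrivial (S : Subalgebra F D₁) (π : D₁) (hπS : π ∈ S) (hπ0 : π ≠ 0)
    (hπunit : ¬ IsUnit (⟨π, hπS⟩ : S))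
    (htwosided : {x : D₁ | ∃ s ∈ S, x = π * s} = {x : D₁ | ∃ s ∈ S, x = s * π}) :
    Nontrivial (RingQuot (fun a b : S => ∃ s : S, a = b + ⟨π, hπS⟩ * s)) := by
  let p : S := ⟨π, hπS⟩
  have hcomm : ∀ s : S, ∃ s' : S, s * p = p * s' := fun s => by
    have : (s : D₁) * π ∈ {x : D₁ | ∃ s ∈ S, x = π * s} := by
      rw [htwosided]; exact ⟨s, s.2, rfl⟩
    obtain ⟨t, ht, h⟩ := this
    exact ⟨⟨t, ht⟩, Subtype.ext h⟩
  let I : TwoSidedIdeal S := TwoSidedIdeal.mk' {x | ∃ s : S, x = p * s}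
    ⟨0, by simp⟩
    (by rintro _ _ ⟨a, rfl⟩ ⟨b, rfl⟩; exact ⟨a + b, by rw [mul_add]⟩)
    (by rintro _ ⟨a, rfl⟩; exact ⟨-a, by rw [mul_neg]⟩)
    (by
      rintro x _ ⟨a, rfl⟩
      obtain ⟨x', hx⟩ := hcomm x
      exact ⟨x' * a, by rw [← mul_assoc, hx, mul_assoc]⟩)
    (by rintro _ x ⟨a, rfl⟩; exact ⟨a * x, by rw [mul_assoc]⟩)
  have hI : ∀ x, x ∈ I ↔ ∃ s : S, x = p * s := fun x => by
    simp [I, TwoSidedIdeal.mem_mk']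
  let g : RingQuot (fun a b : S => ∃ s : S, a = b + p * s) →+* I.ringCon.Quotient :=
    RingQuot.lift ⟨I.ringCon.mk', by
      rintro a b ⟨s, rfl⟩
      refine (RingCon.eq I.ringCon).2 ?_
      rw [TwoSidedIdeal.rel_iff, hI]
      exact ⟨s, by simp⟩⟩
  refine ⟨0, 1, fun h01 => hπunit ?_⟩
  have h := congrArg g h01
  rw [map_zero, map_one] at h
  have h' : I.ringCon 1 0 := (RingCon.eq I.ringCon).1 h.symm
  rw [TwoSidedIdeal.rel_iff, hI] at h'
  obtain ⟨s, hs⟩ := h'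
  rw [sub_zero] at hs
  have hs' : (1 : D₁) = π * s := congrArg Subtype.val hs
  have hs2 : (s : D₁) = π⁻¹ := (eq_inv_of_mul_eq_one_right hs'.symm)
  refine ⟨⟨p, s, hs.symm, Subtype.ext ?_⟩, rfl⟩
  change (s : D₁) * π = 1
  rw [hs2, inv_mul_cancel₀ hπ0]

end aux

/-- Let `F` be an algebraically closed field, `D₁` a division ring which is an `F`-algebra,
`S` a subring of `D₁` containing the image of `F` (i.e. an `F`-subalgebra), and `π ∈ S` a
nonzero non-unit of `S` with `πS = Sπ` and such that every nonzero element of `D₁` is of the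
form `u·πⁿ` with `u` a unit of `S` and `n ∈ ℤ`.  Let `D₂` be a division ring which is an
`F`-algebra.  If `D₁ ⊗[F] D₂` has a zero divisor, then so does `(S/πS) ⊗[F] D₂`, where
`S/πS` is the quotient ring of `S` by the (two-sided) ideal `πS`, realized as the ring
quotient of `S` by the relation `a ∼ b ↔ a - b ∈ πS`. -/
theorem zero_divisor_descends_to_residue_ring
    (F D₁ : Type*) [Field F] [IsAlgClosed F] [DivisionRing D₁] [Algebra F D₁]
    (S : Subalgebra F D₁) (π : D₁) (hπS : π ∈ S) (hπ0 : π ≠ 0)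
    (hπunit : ¬ IsUnit (⟨π, hπS⟩ : S))
    (htwosided : {x : D₁ | ∃ s ∈ S, x = π * s} = {x : D₁ | ∃ s ∈ S, x = s * π})
    (hval : ∀ d : D₁, d ≠ 0 → ∃ u : Sˣ, ∃ n : ℤ, d = ((u : S) : D₁) * π ^ n)
    (D₂ : Type*) [DivisionRing D₂] [Algebra F D₂]
    (h : ∃ α₁ α₂ : D₁ ⊗[F] D₂, α₁ ≠ 0 ∧ α₂ ≠ 0 ∧ α₁ * α₂ = 0) :
    ∃ β₁ β₂ : (RingQuot (fun a b : S => ∃ s : S, a = b + ⟨π, hπS⟩ * s)) ⊗[F] D₂,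
      β₁ ≠ 0 ∧ β₂ ≠ 0 ∧ β₁ * β₂ = 0 := by
  classical
  have := aux_nontrivial S π hπS hπ0 hπunit htwosided
  have hS : ∀ d : D₁, d ≠ 0 → d ∈ S ∨ d⁻¹ ∈ S := by
    intro d hd
    obtain ⟨u, n, rfl⟩ := hval d hd
    rcases n with n | n
    · left
      simpa using S.mul_mem (u : S).2 (S.pow_mem hπS n)
    · right
      have hu : (((u : S) : D₁))⁻¹ = ((u⁻¹ : Sˣ) : S) := by
        refine inv_eq_of_mul_eq_one_right ?_
        exact congrArg Subtype.val u.mul_inv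
      rw [mul_inv_rev, zpow_negSucc, inv_inv, hu]
      exact S.mul_mem (S.pow_mem hπS _) (SetLike.coe_mem _)
  obtain ⟨α₁, α₂, h₁, h₂, h₁₂⟩ := h
  let b := Module.Free.chooseBasis F D₂
  let B := Algebra.TensorProduct.basis D₁ b
  have hne : ∀ α : D₁ ⊗[F] D₂, α ≠ 0 → (B.repr α).support.Nonempty := by
    intro α hα
    rw [Finsupp.support_nonempty_iff]
    simpa using hα
  let q : S →ₐ[F] RingQuot (fun a b : S => ∃ s : S, a = b + ⟨π, hπS⟩ * s) :=
    RingQuot.mkAlgHom F _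
  obtain ⟨i, hi, hij⟩ := aux_min_left S hS (B.repr α₁) _ (hne α₁ h₁) (by simp)
  obtain ⟨k, hk, hkj⟩ := aux_min_right S hS (B.repr α₂) _ (hne α₂ h₂) (by simp)
  obtain ⟨γ₁, hγ₁, hq₁⟩ := aux_lift b S q (((B.repr α₁ i)⁻¹ ⊗ₜ 1) * α₁)
    (fun j => by
      rw [aux_mul_repr]
      by_cases hj : j ∈ (B.repr α₁).support
      · exact hij j hj
      · have : B.repr α₁ j = 0 := by simpa using hj
        change _ * B.repr α₁ j ∈ S
        rw [this, mul_zero]; exact S.zero_mem) i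
    (by rw [aux_mul_repr]; exact inv_mul_cancel₀ (by simpa using hi))
  obtain ⟨γ₂, hγ₂, hq₂⟩ := aux_lift b S q (α₂ * ((B.repr α₂ k)⁻¹ ⊗ₜ 1))
    (fun j => by
      rw [aux_repr_mul]
      by_cases hj : j ∈ (B.repr α₂).support
      · exact hkj j hj
      · have : B.repr α₂ j = 0 := by simpa using hj
        change B.repr α₂ j * _ ∈ S
        rw [this, zero_mul]; exact S.zero_mem) k
    (by rw [aux_repr_mul]; exact mul_inv_cancel₀ (by simpa using hk))
  refine ⟨_, _, hq₁, hq₂, ?_⟩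
  have hinj : Function.Injective (Algebra.TensorProduct.map S.val (AlgHom.id F D₂)) :=
    Module.Flat.rTensor_preserves_injective_linearMap (M := D₂) S.val.toLinearMap
      Subtype.val_injective
  have h0 : γ₁ * γ₂ = 0 := by
    apply hinj
    rw [map_mul, hγ₁, hγ₂, map_zero, mul_assoc, ← mul_assoc α₁, h₁₂, zero_mul, mul_zero]
  rw [← map_mul, h0, map_zero]
end

section
/- Let F be an algebraically closed field, let F₁ and F₂ be field extensions of F, and for i = 1, 2 let Dᵢ be a division ring that is a finite-dimensional Fᵢ-algebra whose center is exactly Fᵢ. Let R = F₁ ⊗_F F₂ (an integral domain) and let K be its field of fractions, with the natural maps Fᵢ → R → K. Then D₁ ⊗_F D₂ has no zero divisors if and only if (D₁ ⊗_{F₁} K) ⊗_K (D₂ ⊗_{F₂} K) is a division ring. -/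
open scoped TensorProduct

attribute [local instance] Algebra.TensorProduct.rightAlgebra

/-- Abstract version: `B` is any `K`-algebra with a `K`-basis of products `ι₁ (e i) * ι₂ (f j)`. -/
theorem tensor_aux
    (F F₁ F₂ D₁ D₂ : Type*) [Field F] [Field F₁] [Field F₂]
    [Algebra F F₁] [Algebra F F₂]
    [DivisionRing D₁] [DivisionRing D₂] [Algebra F₁ D₁] [Algebra F₂ D₂]
    [Algebra F D₁] [Algebra F D₂] [IsScalarTower F F₁ D₁] [IsScalarTower F F₂ D₂]
    [IsDomain (F₁ ⊗[F] F₂)]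
    (K : Type*) [Field K] [Algebra (F₁ ⊗[F] F₂) K] [IsFractionRing (F₁ ⊗[F] F₂) K]
    (B : Type*) [Ring B] [Algebra K B]
    (ι₁ : D₁ →+* B) (ι₂ : D₂ →+* B) (hcomm : ∀ x y, Commute (ι₁ x) (ι₂ y))
    (h₁ : ∀ a : F₁, ι₁ (algebraMap F₁ D₁ a) =
      algebraMap K B (algebraMap (F₁ ⊗[F] F₂) K (a ⊗ₜ[F] (1 : F₂))))
    (h₂ : ∀ a : F₂, ι₂ (algebraMap F₂ D₂ a) =
      algebraMap K B (algebraMap (F₁ ⊗[F] F₂) K ((1 : F₁) ⊗ₜ[F] a)))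
    {I J : Type*} [Fintype I] [Fintype J]
    (e : Module.Basis I F₁ D₁) (f : Module.Basis J F₂ D₂) (b : Module.Basis (I × J) K B)
    (hb : ∀ i j, b (i, j) = ι₁ (e i) * ι₂ (f j)) :
    (∀ α₁ α₂ : D₁ ⊗[F] D₂, α₁ ≠ 0 → α₂ ≠ 0 → α₁ * α₂ ≠ 0) ↔
      (Nontrivial B ∧ ∀ x : B, x ≠ 0 → IsUnit x) := by
  letI : Algebra F B := ((algebraMap K B).comp ((algebraMap (F₁ ⊗[F] F₂) K).comp
    (algebraMap F (F₁ ⊗[F] F₂)))).toAlgebra' (fun c x => Algebra.commutes _ _)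
  have hF : ∀ c : F, algebraMap F B c = algebraMap K B (algebraMap (F₁ ⊗[F] F₂) K
    (algebraMap F (F₁ ⊗[F] F₂) c)) := fun c => rfl
  let j₁ : D₁ →ₐ[F] B := { ι₁ with
    commutes' := fun c => by
      change ι₁ _ = _
      rw [IsScalarTower.algebraMap_apply F F₁ D₁, h₁, hF]
      rfl }
  let j₂ : D₂ →ₐ[F] B := { ι₂ with
    commutes' := fun c => by
      change ι₂ _ = _
      rw [IsScalarTower.algebraMap_apply F F₂ D₂, h₂, hF]
      have h : (1 : F₁) ⊗ₜ[F] (algebraMap F F₂ c) = algebraMap F (F₁ ⊗[F] F₂) c := by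
        change _ = (algebraMap F F₁ c) ⊗ₜ[F] (1 : F₂)
        rw [Algebra.algebraMap_eq_smul_one c, Algebra.algebraMap_eq_smul_one c,
          TensorProduct.smul_tmul]
      rw [h] }
  let φ : D₁ ⊗[F] D₂ →ₐ[F] B := Algebra.TensorProduct.lift j₁ j₂ hcomm
  have hφ : ∀ x y, φ (x ⊗ₜ y) = ι₁ x * ι₂ y := fun x y => Algebra.TensorProduct.lift_tmul _ _ _ _ _
  let ρ : F₁ ⊗[F] F₂ →ₐ[F] D₁ ⊗[F] D₂ := Algebra.TensorProduct.map
    (IsScalarTower.toAlgHom F F₁ D₁) (IsScalarTower.toAlgHom F F₂ D₂)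
  have hρ : ∀ r, φ (ρ r) = algebraMap K B (algebraMap (F₁ ⊗[F] F₂) K r) := by
    intro r
    induction r with
    | zero => simp
    | add x y hx hy => simp only [map_add, hx, hy]
    | tmul x y =>
      have : ρ (x ⊗ₜ y) = algebraMap F₁ D₁ x ⊗ₜ algebraMap F₂ D₂ y := rfl
      rw [this, hφ, h₁, h₂, ← map_mul, ← map_mul, Algebra.TensorProduct.tmul_mul_tmul,
        mul_one, one_mul]
  let ψ : (I × J → F₁ ⊗[F] F₂) → D₁ ⊗[F] D₂ := fun r => ∑ p, ρ (r p) * (e p.1 ⊗ₜ f p.2)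
  have hψ : ∀ r, φ (ψ r) = ∑ p, (algebraMap (F₁ ⊗[F] F₂) K (r p)) • b p := by
    intro r
    simp only [ψ, map_sum, map_mul, hρ, hφ, Algebra.smul_def]
    exact Finset.sum_congr rfl fun p _ => by rw [← hb]
  have hsurj : ∀ a, ∃ r, ψ r = a := by
    intro a
    induction a with
    | zero => exact ⟨0, by simp [ψ]⟩
    | add x y hx hy =>
      obtain ⟨r, rfl⟩ := hx
      obtain ⟨s, rfl⟩ := hy
      exact ⟨r + s, by simp [ψ, add_mul, Finset.sum_add_distrib]⟩
    | tmul x y =>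
      refine ⟨fun p => e.repr x p.1 ⊗ₜ f.repr y p.2, ?_⟩
      conv_rhs => rw [← e.sum_repr x, ← f.sum_repr y, TensorProduct.sum_tmul]
      simp only [TensorProduct.tmul_sum, ψ]
      rw [Fintype.sum_prod_type]
      refine Finset.sum_congr rfl fun i _ => Finset.sum_congr rfl fun k _ => ?_
      have : ρ (e.repr x i ⊗ₜ f.repr y k) =
        algebraMap F₁ D₁ (e.repr x i) ⊗ₜ algebraMap F₂ D₂ (f.repr y k) := rfl
      rw [this, Algebra.TensorProduct.tmul_mul_tmul, Algebra.smul_def, Algebra.smul_def]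
  have hinj : ∀ a, φ a = 0 → a = 0 := by
    intro a ha
    obtain ⟨r, rfl⟩ := hsurj a
    rw [hψ] at ha
    have h := Fintype.linearIndependent_iff.1 b.linearIndependent _ ha
    have hr : ∀ p, r p = 0 := fun p =>
      (IsFractionRing.injective (F₁ ⊗[F] F₂) K) (by rw [h p, map_zero])
    simp [ψ, hr]
  have hden : ∀ x : B, ∃ (c : K) (a : D₁ ⊗[F] D₂), c ≠ 0 ∧ c • x = φ a := by
    intro x
    obtain ⟨s, hs⟩ := IsLocalization.exist_integer_multiples_of_finite
      (nonZeroDivisors (F₁ ⊗[F] F₂)) (fun p => b.repr x p)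
    choose r hr using hs
    refine ⟨algebraMap (F₁ ⊗[F] F₂) K s, ψ r, ?_, ?_⟩
    · exact IsFractionRing.to_map_ne_zero_of_mem_nonZeroDivisors s.2
    · rw [hψ]
      conv_lhs => rw [← b.sum_repr x, Finset.smul_sum]
      refine Finset.sum_congr rfl fun p _ => ?_
      rw [hr, smul_smul, Algebra.smul_def (s : F₁ ⊗[F] F₂)]
  constructor
  · intro hA
    haveI : Nontrivial (D₁ ⊗[F] D₂) := inferInstance
    refine ⟨⟨⟨1, 0, fun h => ?_⟩⟩, ?_⟩
    · exact one_ne_zero (hinj 1 (by rw [map_one, h]))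
    have hB : ∀ x y : B, x ≠ 0 → x * y = 0 → y = 0 := by
      intro x y hx hxy
      by_contra hy
      obtain ⟨c, a, hc, hca⟩ := hden x
      obtain ⟨d, a', hd, hda⟩ := hden y
      refine hA a a' ?_ ?_ (hinj _ ?_)
      · rintro rfl
        rw [map_zero] at hca
        exact (smul_ne_zero hc hx) hca
      · rintro rfl
        rw [map_zero] at hda
        exact (smul_ne_zero hd hy) hda
      · rw [map_mul, ← hca, ← hda, smul_mul_smul_comm, hxy, smul_zero]
    haveI : FiniteDimensional K B := b.finiteDimensional_of_finite
    have hinv : ∀ x : B, x ≠ 0 → ∃ y, x * y = 1 := by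
      intro x hx
      have hi : Function.Injective (LinearMap.mulLeft K x) :=
        (injective_iff_map_eq_zero _).2 fun y hy => hB x y hx hy
      exact LinearMap.surjective_of_injective hi 1
    intro x hx
    obtain ⟨y, hy⟩ := hinv x hx
    refine ⟨⟨x, y, hy, ?_⟩, rfl⟩
    have : x * (y * x - 1) = 0 := by rw [mul_sub, ← mul_assoc, hy, one_mul, mul_one, sub_self]
    exact sub_eq_zero.1 (hB x _ hx this)
  · rintro ⟨_, hB⟩ a a' ha ha' h
    have h1 : IsUnit (φ a) := hB _ fun h => ha (hinj _ h)
    have h2 : φ a * φ a' = 0 := by rw [← map_mul, h, map_zero]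
    exact ha' (hinj _ (h1.mul_right_eq_zero.1 h2))

/-- Let `F` be an algebraically closed field, `F₁, F₂` field extensions of `F`, and for
`i = 1, 2` let `Dᵢ` be a division ring which is a finite-dimensional `Fᵢ`-algebra with center
exactly `Fᵢ`.  Let `R = F₁ ⊗[F] F₂` (an integral domain) and let `K` be its field of
fractions, the `Fᵢ` mapping to `K` through `R`.  Then `D₁ ⊗[F] D₂` has no zero divisors if
and only if `(D₁ ⊗[F₁] K) ⊗[K] (D₂ ⊗[F₂] K)` is a division ring. -/
theorem tensor_no_zero_divisors_iff_scalar_extension_divisionRing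
    (F F₁ F₂ D₁ D₂ : Type*) [Field F] [IsAlgClosed F] [Field F₁] [Field F₂]
    [Algebra F F₁] [Algebra F F₂]
    [DivisionRing D₁] [DivisionRing D₂] [Algebra F₁ D₁] [Algebra F₂ D₂]
    [FiniteDimensional F₁ D₁] [FiniteDimensional F₂ D₂]
    (hc₁ : Subring.center D₁ = (algebraMap F₁ D₁).range)
    (hc₂ : Subring.center D₂ = (algebraMap F₂ D₂).range)
    [Algebra F D₁] [Algebra F D₂] [IsScalarTower F F₁ D₁] [IsScalarTower F F₂ D₂]
    [IsDomain (F₁ ⊗[F] F₂)]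
    (K : Type*) [Field K] [Algebra (F₁ ⊗[F] F₂) K] [IsFractionRing (F₁ ⊗[F] F₂) K]
    [Algebra F₁ K] [IsScalarTower F₁ (F₁ ⊗[F] F₂) K]
    [Algebra F₂ K]
    (hF₂K : ∀ b : F₂, algebraMap F₂ K b = algebraMap (F₁ ⊗[F] F₂) K ((1 : F₁) ⊗ₜ[F] b)) :
    (∀ α₁ α₂ : D₁ ⊗[F] D₂, α₁ ≠ 0 → α₂ ≠ 0 → α₁ * α₂ ≠ 0) ↔
      (Nontrivial ((D₁ ⊗[F₁] K) ⊗[K] (D₂ ⊗[F₂] K)) ∧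
        ∀ x : (D₁ ⊗[F₁] K) ⊗[K] (D₂ ⊗[F₂] K), x ≠ 0 → IsUnit x) := by
  have e := Module.finBasis F₁ D₁
  have f := Module.finBasis F₂ D₂
  let e' : Module.Basis _ K (D₁ ⊗[F₁] K) := (Algebra.TensorProduct.basis K e).map
    (Algebra.TensorProduct.commRight F₁ K D₁).toLinearEquiv
  let f' : Module.Basis _ K (D₂ ⊗[F₂] K) := (Algebra.TensorProduct.basis K f).map
    (Algebra.TensorProduct.commRight F₂ K D₂).toLinearEquiv
  have he : ∀ i, e' i = e i ⊗ₜ 1 := by intro i; simp [e']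
  have hf : ∀ i, f' i = f i ⊗ₜ 1 := by intro i; simp [f']
  refine tensor_aux F F₁ F₂ D₁ D₂ K ((D₁ ⊗[F₁] K) ⊗[K] (D₂ ⊗[F₂] K))
    ((Algebra.TensorProduct.includeLeft (R := K) (S := K) (A := D₁ ⊗[F₁] K)
      (B := D₂ ⊗[F₂] K)).toRingHom.comp
      (Algebra.TensorProduct.includeLeft (R := F₁) (S := F₁) (A := D₁) (B := K)).toRingHom)
    ((Algebra.TensorProduct.includeRight (R := K) (A := D₁ ⊗[F₁] K)
      (B := D₂ ⊗[F₂] K)).toRingHom.comp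
      (Algebra.TensorProduct.includeLeft (R := F₂) (S := F₂) (A := D₂) (B := K)).toRingHom)
    ?_ ?_ ?_ e f (e'.tensorProduct f') ?_
  · intro x y
    change (x ⊗ₜ[F₁] (1 : K)) ⊗ₜ[K] (1 : D₂ ⊗[F₂] K) * (1 : D₁ ⊗[F₁] K) ⊗ₜ[K] (y ⊗ₜ[F₂] (1 : K))
      = (1 : D₁ ⊗[F₁] K) ⊗ₜ[K] (y ⊗ₜ[F₂] (1 : K)) * (x ⊗ₜ[F₁] (1 : K)) ⊗ₜ[K] (1 : D₂ ⊗[F₂] K)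
    simp only [Algebra.TensorProduct.tmul_mul_tmul, mul_one, one_mul]
  · intro a
    have h : algebraMap (F₁ ⊗[F] F₂) K (a ⊗ₜ[F] (1 : F₂)) = algebraMap F₁ K a := by
      rw [IsScalarTower.algebraMap_apply F₁ (F₁ ⊗[F] F₂) K]; rfl
    rw [h]
    change (algebraMap F₁ D₁ a ⊗ₜ[F₁] (1 : K)) ⊗ₜ[K] (1 : D₂ ⊗[F₂] K) =
      ((1 : D₁) ⊗ₜ[F₁] (algebraMap F₁ K a)) ⊗ₜ[K] (1 : D₂ ⊗[F₂] K)
    rw [Algebra.algebraMap_eq_smul_one, Algebra.algebraMap_eq_smul_one, TensorProduct.smul_tmul]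
  · intro a
    rw [← hF₂K]
    rw [← (Algebra.TensorProduct.includeRight (R := K) (A := D₁ ⊗[F₁] K)
      (B := D₂ ⊗[F₂] K)).commutes]
    change (1 : D₁ ⊗[F₁] K) ⊗ₜ[K] (algebraMap F₂ D₂ a ⊗ₜ[F₂] (1 : K)) =
      (1 : D₁ ⊗[F₁] K) ⊗ₜ[K] ((1 : D₂) ⊗ₜ[F₂] (algebraMap F₂ K a))
    rw [Algebra.algebraMap_eq_smul_one, Algebra.algebraMap_eq_smul_one, TensorProduct.smul_tmul]
  · intro i j
    rw [Module.Basis.tensorProduct_apply, he, hf]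
    change _ = (e i ⊗ₜ[F₁] (1 : K)) ⊗ₜ[K] (1 : D₂ ⊗[F₂] K) *
      (1 : D₁ ⊗[F₁] K) ⊗ₜ[K] (f j ⊗ₜ[F₂] (1 : K))
    simp only [Algebra.TensorProduct.tmul_mul_tmul, mul_one, one_mul]
end

section
/- Let F be an algebraically closed field of characteristic 0 and let F₁ and F₂ be finitely generated field extensions of F. Then the group of units of F₁ ⊗_F F₂ is isomorphic to (F₁ˣ × F₂ˣ)/Fˣ. Concretely: (i) for every unit u of the ring F₁ ⊗_F F₂ there exist a ∈ F₁ˣ and b ∈ F₂ˣ with u = (a ⊗ 1)·(1 ⊗ b); and (ii) if a ∈ F₁ˣ and b ∈ F₂ˣ satisfy (a ⊗ 1)·(1 ⊗ b) = 1 in F₁ ⊗_F F₂, then a lies in the image of F (and b is the image of a⁻¹). -/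
open scoped TensorProduct

namespace UnitsTensor

/-- Evaluation of `K ⊗ B` at a point `y` of `B`. -/
noncomputable def ev {F K B : Type*} [Field F] [Field K] [CommRing B] [Algebra F K] [Algebra F B]
    (y : B →ₐ[F] F) : K ⊗[F] B →ₐ[F] K :=
  Algebra.TensorProduct.lift (AlgHom.id F K) ((Algebra.ofId F K).comp y) (fun _ _ => Commute.all _ _)

/-- Slice of `K ⊗ B` along a functional on `K`. -/
noncomputable def sl {F K B : Type*} [Field F] [Field K] [CommRing B] [Algebra F K] [Algebra F B]
    (h : K →ₗ[F] F) : K ⊗[F] B →ₗ[F] B :=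
  (TensorProduct.lid F B).toLinearMap ∘ₗ h.rTensor B

section
variable {F K B : Type*} [Field F] [Field K] [CommRing B] [Algebra F K] [Algebra F B]

theorem ev_tmul (y : B →ₐ[F] F) (k : K) (b : B) : ev y (k ⊗ₜ[F] b) = y b • k := by
  rw [ev, Algebra.TensorProduct.lift_tmul, Algebra.smul_def, mul_comm]
  rfl

theorem sl_tmul (h : K →ₗ[F] F) (k : K) (b : B) : sl h (k ⊗ₜ[F] b) = h k • b := by
  simp [sl]

theorem apply_sl (y : B →ₐ[F] F) (h : K →ₗ[F] F) (d : K ⊗[F] B) : y (sl h d) = h (ev y d) := by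
  induction d with
  | zero => simp
  | tmul k b => simp [ev_tmul, sl_tmul, mul_comm]
  | add a b ha hb => simp [ha, hb]

theorem repr_sl {ι : Type*} [DecidableEq ι] (β : Module.Basis ι F B) (h : K →ₗ[F] F) (d : K ⊗[F] B) (i : ι) :
    β.repr (sl h d) i = h (TensorProduct.equivFinsuppOfBasisRight β d i) := by
  induction d with
  | zero => simp
  | tmul k b => simp [sl_tmul, mul_comm]
  | add a b ha hb => simp [ha, hb]

theorem ev_eq_sum {ι : Type*} [DecidableEq ι] (β : Module.Basis ι F B) (y : B →ₐ[F] F) (d : K ⊗[F] B) :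
    ev y d = ∑ i ∈ (TensorProduct.equivFinsuppOfBasisRight β d).support,
      y (β i) • TensorProduct.equivFinsuppOfBasisRight β d i := by
  conv_lhs => rw [← (TensorProduct.equivFinsuppOfBasisRight β).symm_apply_apply d,
    TensorProduct.equivFinsuppOfBasisRight_symm_apply]
  simp [Finsupp.sum, ev_tmul]

theorem eq_zero_of_sl (d : K ⊗[F] B) (H : ∀ h : K →ₗ[F] F, sl h d = 0) : d = 0 := by
  classical
  let β := Module.Basis.ofVectorSpace F B
  apply (TensorProduct.equivFinsuppOfBasisRight β).injective
  rw [map_zero]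
  ext i
  by_contra hne
  obtain ⟨h, hh, -⟩ := Submodule.exists_le_ker_of_notMem (K := F) (p := ⊥)
    (v := TensorProduct.equivFinsuppOfBasisRight β d i) (by simpa using hne)
  apply hh
  rw [← repr_sl, H]
  simp

theorem exists_point [IsAlgClosed F] [IsDomain B] [Algebra.FiniteType F B] (b : B) (hb : b ≠ 0) :
    ∃ y : B →ₐ[F] F, y b ≠ 0 := by
  let L := Localization.Away b
  have : Algebra.FinitePresentation B L := IsLocalization.Away.finitePresentation b
  have : Algebra.FiniteType B L := inferInstance
  have : Algebra.FiniteType F L := Algebra.FiniteType.trans (S := B) inferInstance inferInstance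
  have : Nontrivial L := (IsLocalization.injective L
    (powers_le_nonZeroDivisors_of_noZeroDivisors hb)).nontrivial
  obtain ⟨m, hm⟩ := Ideal.exists_maximal L
  let : Field (L ⧸ m) := Ideal.Quotient.field m
  have : Module.Finite F (L ⧸ m) := finite_of_finite_type_of_isJacobsonRing F (L ⧸ m)
  let φ : (L ⧸ m) →ₐ[F] F := IsAlgClosed.lift
  refine ⟨(φ.comp (Ideal.Quotient.mkₐ F m)).comp (IsScalarTower.toAlgHom F B L), ?_⟩
  have : IsUnit (algebraMap B L b) := IsLocalization.Away.algebraMap_isUnit b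
  exact (this.map ((φ.comp (Ideal.Quotient.mkₐ F m)))).ne_zero

theorem eq_of_evals [IsAlgClosed F] [IsDomain B] [Algebra.FiniteType F B] (d : K ⊗[F] B)
    (H : ∀ y : B →ₐ[F] F, ev y d = 0) : d = 0 := by
  refine eq_zero_of_sl d fun h => ?_
  by_contra hne
  obtain ⟨y, hy⟩ := exists_point (F := F) _ hne
  exact hy (by rw [apply_sl, H, map_zero])

theorem valuation_bound (V : ValuationSubring K) (hV : ∀ c : F, algebraMap F K c ∈ V)
    (d : K ⊗[F] B) (hd : d ≠ 0) : ∃ (a : K) (b : B), a ≠ 0 ∧ b ≠ 0 ∧ ∀ y : B →ₐ[F] F,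
      V.valuation (ev y d) ≤ V.valuation a ∧
      (y b ≠ 0 → V.valuation (ev y d) = V.valuation a) := by
  classical
  let β := Module.Basis.ofVectorSpace F B
  set f := TensorProduct.equivFinsuppOfBasisRight β d with hf
  have hsm : ∀ (c : F) (k : K), V.valuation (c • k) ≤ V.valuation k := by
    intro c k
    rw [Algebra.smul_def, map_mul]
    exact mul_le_of_le_one_left' ((V.valuation_le_one_iff _).2 (hV c))
  have hf0 : f ≠ 0 := by simpa [hf] using hd
  obtain ⟨m, hm, hmax⟩ := f.support.exists_max_image (fun i => V.valuation (f i))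
    (Finsupp.support_nonempty_iff.2 hf0)
  have ha : f m ≠ 0 := by simpa using hm
  let M : Submodule F K :=
    { carrier := {x | V.valuation x < 1}
      zero_mem' := by simp
      add_mem' := fun {x y} hx hy => (V.valuation.map_add_lt hx hy)
      smul_mem' := fun c x hx => (hsm c x).trans_lt hx }
  obtain ⟨h, h1, hM⟩ := Submodule.exists_le_ker_of_notMem (K := F) (p := M) (v := 1)
    (by change ¬ (V.valuation (1 : K) < 1); simp)
  have hle : ∀ y : B →ₐ[F] F, V.valuation (ev y d) ≤ V.valuation (f m) := by
    intro y
    rw [ev_eq_sum β]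
    refine V.valuation.map_sum_le fun i hi => ?_
    exact (hsm _ _).trans (hmax i hi)
  let h' : K →ₗ[F] F := h ∘ₗ LinearMap.mulLeft F (f m)⁻¹
  refine ⟨f m, sl h' d, ha, ?_, fun y => ⟨hle y, fun hy => ?_⟩⟩
  · intro h0
    have := repr_sl β h' d m
    rw [h0] at this
    apply h1
    simpa [h', ← hf, ha] using this.symm
  · refine (hle y).antisymm (not_lt.1 fun hlt => hy ?_)
    rw [apply_sl]
    apply hM
    change V.valuation ((f m)⁻¹ * ev y d) < 1
    rw [map_mul, map_inv₀, inv_mul_lt_iff₀ (by simpa [zero_lt_iff] using ha)]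
    simpa using hlt

theorem mem_range_of_valuation [IsAlgClosed F] (x : K)
    (H : ∀ V : ValuationSubring K, (∀ c : F, algebraMap F K c ∈ V) → x ∈ V) :
    ∃ c : F, algebraMap F K c = x := by
  have hx : x ∈ integralClosure F K := by
    by_contra hx
    have : IsIntegrallyClosedIn (integralClosure F K).toSubring K :=
      inferInstanceAs (IsIntegrallyClosedIn (integralClosure F K) K)
    obtain ⟨V, hV, hxV⟩ := Subring.exists_le_valuationSubring_of_isIntegrallyClosedIn
      (R := (integralClosure F K).toSubring) (x := x) hx
    exact hxV (H V fun c => hV ((integralClosure F K).algebraMap_mem c))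
  obtain ⟨c, hc⟩ := (IsAlgClosed.algebraMap_bijective_of_isIntegral
    (k := F) (K := integralClosure F K)).2 ⟨x, hx⟩
  exact ⟨c, congrArg Subtype.val hc⟩

theorem ev_ratio [IsAlgClosed F] [IsDomain B] [Algebra.FiniteType F B] (u w : K ⊗[F] B)
    (huw : u * w = 1) (y y' : B →ₐ[F] F) : ∃ c : F, algebraMap F K c = (ev y' u)⁻¹ * ev y u := by
  have hev : ∀ y : B →ₐ[F] F, ev y u * ev y w = 1 := fun y => by rw [← map_mul, huw, map_one]
  have hnt : (1 : K ⊗[F] B) ≠ 0 := fun h => by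
    have := congrArg (ev y) h
    simp at this
  apply mem_range_of_valuation
  intro V hV
  obtain ⟨a, b, ha, hb, h1⟩ := valuation_bound V hV u (fun h => hnt (by rw [← huw, h, zero_mul]))
  obtain ⟨a', b', ha', hb', h2⟩ := valuation_bound V hV w
    (fun h => hnt (by rw [← huw, h, mul_zero]))
  obtain ⟨z, hz⟩ := exists_point (F := F) (b * b') (mul_ne_zero hb hb')
  rw [map_mul] at hz
  have hvv : ∀ y : B →ₐ[F] F, V.valuation (ev y u) * V.valuation (ev y w) = 1 := fun y => by
    rw [← map_mul, hev, map_one]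
  have haa : V.valuation a * V.valuation a' = 1 := by
    rw [← (h1 z).2 (left_ne_zero_of_mul hz), ← (h2 z).2 (right_ne_zero_of_mul hz), hvv]
  have key : ∀ y : B →ₐ[F] F, V.valuation (ev y u) = V.valuation a := by
    intro y
    refine (h1 y).1.antisymm ?_
    calc V.valuation a = V.valuation a * (V.valuation (ev y u) * V.valuation (ev y w)) := by
          rw [hvv, mul_one]
      _ ≤ V.valuation a * (V.valuation (ev y u) * V.valuation a') := by
          gcongr
          exact (h2 y).1
      _ = V.valuation (ev y u) := by rw [mul_left_comm, haa, mul_one]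
  rw [← V.valuation_le_one_iff, map_mul, map_inv₀, key, key,
    inv_mul_cancel₀ (by simpa using ha)]

theorem unit_fg [IsAlgClosed F] [IsDomain B] [Algebra.FiniteType F B] (u w : K ⊗[F] B)
    (huw : u * w = 1) : ∃ (a : K) (b : B), u = a ⊗ₜ[F] b := by
  obtain ⟨y₀, -⟩ := exists_point (F := F) (1 : B) one_ne_zero
  have ha : ev y₀ u ≠ 0 := left_ne_zero_of_mul (b := ev y₀ w) (by
    rw [← map_mul, huw, map_one]; exact one_ne_zero)
  obtain ⟨g, hg⟩ := LinearMap.exists_leftInverse_of_injective (Algebra.linearMap F K)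
    (LinearMap.ker_eq_bot.2 (algebraMap F K).injective)
  let g' : K →ₗ[F] F := g ∘ₗ LinearMap.mulLeft F (ev y₀ u)⁻¹
  refine ⟨ev y₀ u, sl g' u, ?_⟩
  rw [← sub_eq_zero]
  apply eq_of_evals
  intro y
  obtain ⟨c, hc⟩ := ev_ratio u w huw y y₀
  have hgc : g (algebraMap F K c) = c := by simpa using LinearMap.congr_fun hg c
  rw [map_sub, ev_tmul, apply_sl, sub_eq_zero]
  have : g' (ev y u) = c := by
    change g ((ev y₀ u)⁻¹ * ev y u) = c
    rw [← hc, hgc]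
  rw [this, Algebra.smul_def, hc]
  field_simp

end

theorem exists_descent {F K L : Type*} [Field F] [Field K] [Field L] [Algebra F K] [Algebra F L]
    (u w : K ⊗[F] L) : ∃ B : Subalgebra F L, Algebra.FiniteType F B ∧
      ∃ u' w' : K ⊗[F] B, Algebra.TensorProduct.map (AlgHom.id F K) B.val u' = u ∧
        Algebra.TensorProduct.map (AlgHom.id F K) B.val w' = w := by
  obtain ⟨N, hN, hs⟩ := TensorProduct.exists_finite_submodule_right_of_setFinite {u, w}
    (Set.toFinite _)
  obtain ⟨s, rfl⟩ := Module.Finite.iff_fg.1 hN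
  let B := Algebra.adjoin F (s : Set L)
  have hle : Submodule.span F (s : Set L) ≤ Subalgebra.toSubmodule B :=
    Algebra.span_le_adjoin F _
  have key : ∀ x ∈ LinearMap.range ((Submodule.span F (s : Set L)).subtype.lTensor K),
      ∃ x' : K ⊗[F] B, Algebra.TensorProduct.map (AlgHom.id F K) B.val x' = x := by
    rintro _ ⟨x, rfl⟩
    refine ⟨(Submodule.inclusion hle).lTensor K x, ?_⟩
    induction x with
    | zero => simp
    | tmul k b => simp
    | add a b ha hb => simp only [map_add, ha, hb]
  obtain ⟨u', hu'⟩ := key u (hs (by simp))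
  obtain ⟨w', hw'⟩ := key w (hs (by simp))
  exact ⟨B, (Subalgebra.fg_iff_finiteType _).1 ⟨s, rfl⟩, u', w', hu', hw'⟩

theorem unit_eq {F K L : Type*} [Field F] [IsAlgClosed F] [Field K] [Field L] [Algebra F K]
    [Algebra F L] (u w : K ⊗[F] L) (huw : u * w = 1) : ∃ (a : K) (b : L), u = a ⊗ₜ[F] b := by
  obtain ⟨B, hB, u', w', rfl, rfl⟩ := exists_descent u w
  have hinj : Function.Injective (Algebra.TensorProduct.map (AlgHom.id F K) B.val) :=
    Module.Flat.lTensor_preserves_injective_linearMap (M := K) B.val.toLinearMap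
      Subtype.val_injective
  obtain ⟨a, b, rfl⟩ := unit_fg u' w' (hinj (by rw [map_mul, huw, map_one]))
  exact ⟨a, b, by simp⟩

end UnitsTensor

/-- Let `F` be an algebraically closed field of characteristic `0` and `F₁, F₂` finitely
generated field extensions of `F`.  Then the units of `F₁ ⊗[F] F₂` are exactly
`(F₁ˣ × F₂ˣ)/Fˣ`:  (i) every unit `u` of `F₁ ⊗[F] F₂` has the form `(a ⊗ 1)·(1 ⊗ b)` with
`a ∈ F₁ˣ`, `b ∈ F₂ˣ`, and (ii) if `(a ⊗ 1)·(1 ⊗ b) = 1` then `a` is the image of some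
`c ∈ F` and `b` is the image of `c⁻¹`. -/
theorem units_of_tensorProduct_of_fg_field_extensions
    (F F₁ F₂ : Type*) [Field F] [IsAlgClosed F] [CharZero F] [Field F₁] [Field F₂]
    [Algebra F F₁] [Algebra F F₂]
    (hfg₁ : (⊤ : IntermediateField F F₁).FG) (hfg₂ : (⊤ : IntermediateField F F₂).FG) :
    (∀ u : (F₁ ⊗[F] F₂)ˣ, ∃ (a : F₁ˣ) (b : F₂ˣ),
        (u : F₁ ⊗[F] F₂) = ((a : F₁) ⊗ₜ[F] (1 : F₂)) * ((1 : F₁) ⊗ₜ[F] (b : F₂))) ∧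
    (∀ (a : F₁ˣ) (b : F₂ˣ),
        ((a : F₁) ⊗ₜ[F] (1 : F₂)) * ((1 : F₁) ⊗ₜ[F] (b : F₂)) = 1 →
        ∃ c : F, algebraMap F F₁ c = (a : F₁) ∧ algebraMap F F₂ c⁻¹ = (b : F₂)) := by
  refine ⟨fun u => ?_, fun a b hab => ?_⟩
  · obtain ⟨a, b, hab⟩ := UnitsTensor.unit_eq (u : F₁ ⊗[F] F₂) _ u.mul_inv
    have ha : a ≠ 0 := by
      rintro rfl
      exact u.ne_zero (by rw [hab, TensorProduct.zero_tmul])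
    have hb : b ≠ 0 := by
      rintro rfl
      exact u.ne_zero (by rw [hab, TensorProduct.tmul_zero])
    exact ⟨Units.mk0 a ha, Units.mk0 b hb, by simp [hab]⟩
  · rw [Algebra.TensorProduct.tmul_mul_tmul, mul_one, one_mul] at hab
    obtain ⟨g, hg⟩ := LinearMap.exists_leftInverse_of_injective (Algebra.linearMap F F₁)
      (LinearMap.ker_eq_bot.2 (algebraMap F F₁).injective)
    have hg1 : g 1 = 1 := by simpa using LinearMap.congr_fun hg 1
    have h1 : g a • (b : F₂) = 1 := by
      have := congrArg (UnitsTensor.sl g) hab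
      rwa [UnitsTensor.sl_tmul, Algebra.TensorProduct.one_def, UnitsTensor.sl_tmul, hg1,
        one_smul] at this
    have hc : g a ≠ 0 := by
      intro h
      rw [h, zero_smul] at h1
      exact zero_ne_one h1
    have hb : (b : F₂) = algebraMap F F₂ (g a)⁻¹ := by
      rw [Algebra.algebraMap_eq_smul_one, ← h1, smul_smul, inv_mul_cancel₀ hc, one_smul]
    refine ⟨g a, ?_, hb.symm⟩
    have h2 : ((g a)⁻¹ • (a : F₁)) ⊗ₜ[F] (1 : F₂) = (1 : F₁) ⊗ₜ[F] (1 : F₂) := by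
      rw [TensorProduct.smul_tmul, ← Algebra.algebraMap_eq_smul_one, ← hb, hab]
      rfl
    have h3 := Algebra.TensorProduct.includeLeft_injective (S := F) (A := F₁) (B := F₂)
      (algebraMap F F₂).injective h2
    rw [Algebra.algebraMap_eq_smul_one, ← h3, smul_smul, mul_inv_cancel₀ hc, one_smul]
end

section
/- Let F be an algebraically closed field of characteristic 0, let F₂ be a finitely generated field extension of F, and let K be an arbitrary field extension of F. Then the Picard group of the commutative ring K ⊗_F F₂ is torsion-free: if M is an invertible module over K ⊗_F F₂ such that the n-fold tensor power M^{⊗n} is a free module for some integer n ≥ 1, then M itself is free. -/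
open scoped TensorProduct
open scoped TensorProduct nonZeroDivisors
set_option linter.style.haveILetI false

section P6Sec
open PowerSeries

theorem C_prime_aux {O : Type*} [CommRing O] [IsDomain O] {p : O} (hp : Prime p) :
    Prime (PowerSeries.C p : O⟦X⟧) := by
  have hker : ∀ φ : O⟦X⟧, (PowerSeries.C p ∣ φ) ↔
      PowerSeries.map (Ideal.Quotient.mk (Ideal.span {p})) φ = 0 := by
    intro φ
    constructor
    · rintro ⟨ψ, rfl⟩
      rw [map_mul, PowerSeries.map_C, (Ideal.Quotient.eq_zero_iff_mem).2
        (Ideal.mem_span_singleton_self p)]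
      simp
    · intro h
      have h2 : ∀ i, p ∣ PowerSeries.coeff i φ := by
        intro i
        have := congrArg (PowerSeries.coeff i) h
        rw [PowerSeries.coeff_map, map_zero, Ideal.Quotient.eq_zero_iff_mem,
          Ideal.mem_span_singleton] at this
        exact this
      choose c hc using h2
      refine ⟨PowerSeries.mk c, ?_⟩
      ext i
      rw [PowerSeries.coeff_C_mul, PowerSeries.coeff_mk, hc]
  have : (Ideal.span {p}).IsPrime := (Ideal.span_singleton_prime hp.ne_zero).2 hp
  refine ⟨?_, ?_, ?_⟩
  · intro h
    exact hp.ne_zero (by simpa using congrArg PowerSeries.constantCoeff h)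
  · intro h
    exact hp.not_isUnit (by simpa using h.map PowerSeries.constantCoeff)
  · intro a b h
    rw [hker, map_mul, mul_eq_zero] at h
    rwa [hker, hker]

theorem divisor_aux {O : Type*} [CommRing O] [IsDomain O] [UniqueFactorizationMonoid O]
    (c : ℕ) : ∀ (d : O) (_ : d ≠ 0) (E E' : O⟦X⟧) (_ : E * E' = PowerSeries.C d * X ^ c),
    ∃ (d1 : O) (i : ℕ) (ε : O⟦X⟧), d1 ≠ 0 ∧ IsUnit ε ∧ E = PowerSeries.C d1 * X ^ i * ε := by
  induction c with
  | zero =>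
    intro d
    induction d using UniqueFactorizationMonoid.induction_on_prime with
    | h₁ => intro h; exact absurd rfl h
    | h₂ x hx =>
      intro _ E E' h
      refine ⟨1, 0, E, one_ne_zero, ?_, by simp⟩
      apply isUnit_of_mul_isUnit_left (y := E')
      rw [h]
      simpa using hx.map (PowerSeries.C (R := O))
    | h₃ a p ha hp ih =>
      intro _ E E' h
      have h1 : PowerSeries.C p ∣ E * E' := ⟨PowerSeries.C a, by rw [h]; simp⟩
      rcases (C_prime_aux hp).dvd_or_dvd h1 with ⟨E1, rfl⟩ | ⟨E1, rfl⟩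
      · have h2 : E1 * E' = PowerSeries.C a * X ^ 0 := by
          apply mul_left_cancel₀ (C_prime_aux hp).ne_zero
          rw [← mul_assoc, h]; simp
        obtain ⟨d1, i, ε, h3, h4, h5⟩ := ih ha E1 E' h2
        refine ⟨p * d1, i, ε, mul_ne_zero hp.ne_zero h3, h4, ?_⟩
        rw [h5, map_mul]; ring
      · have h2 : E * E1 = PowerSeries.C a * X ^ 0 := by
          apply mul_left_cancel₀ (C_prime_aux hp).ne_zero
          rw [mul_left_comm, h]; simp
        exact ih ha E E1 h2
  | succ c ih =>
    intro d hd E E' h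
    have h1 : (X : O⟦X⟧) ∣ E * E' := ⟨PowerSeries.C d * X ^ c, by rw [h]; ring⟩
    rcases (PowerSeries.X_prime).dvd_or_dvd h1 with ⟨E1, rfl⟩ | ⟨E1, rfl⟩
    · have h2 : E1 * E' = PowerSeries.C d * X ^ c := by
        apply mul_left_cancel₀ (PowerSeries.X_prime (R := O)).ne_zero
        rw [← mul_assoc, h]; ring
      obtain ⟨d1, i, ε, h3, h4, h5⟩ := ih d hd E1 E' h2
      refine ⟨d1, i + 1, ε, h3, h4, ?_⟩
      rw [h5]; ring
    · have h2 : E * E1 = PowerSeries.C d * X ^ c := by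
        apply mul_left_cancel₀ (PowerSeries.X_prime (R := O)).ne_zero
        rw [mul_left_comm, h]; ring
      exact ih d hd E E1 h2

theorem nth_root_aux {O : Type*} [CommRing O] [Algebra ℚ O] (n : ℕ) (hn : 1 ≤ n)
    (f : O⟦X⟧) (hf : PowerSeries.constantCoeff f = 1) :
    ∃ w : O⟦X⟧, w ^ n = f ∧ PowerSeries.constantCoeff w = 1 := by
  have hH : HenselianRing O⟦X⟧ (Ideal.span {X}) := inferInstance
  have hmem : ∀ g : O⟦X⟧, g ∈ Ideal.span {(X : O⟦X⟧)} ↔ PowerSeries.constantCoeff g = 0 := by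
    intro g
    rw [Ideal.mem_span_singleton, PowerSeries.X_dvd_iff]
  obtain ⟨w, h1, h2⟩ := hH.is_henselian (Polynomial.X ^ n - Polynomial.C f)
    (Polynomial.monic_X_pow_sub_C f (by omega)) 1
    (by rw [hmem]; simp [hf])
    (by
      rw [Polynomial.derivative_sub, Polynomial.derivative_X_pow, Polynomial.derivative_C]
      simp only [sub_zero, Polynomial.eval_mul, Polynomial.eval_pow, Polynomial.eval_X, one_pow,
        mul_one, Polynomial.eval_C]
      have : IsUnit ((n : ℚ)) := by
        apply IsUnit.mk0; positivity
      have := this.map (algebraMap ℚ (O⟦X⟧ ⧸ Ideal.span {(X : O⟦X⟧)}))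
      simpa using this)
  refine ⟨w, ?_, ?_⟩
  · simpa [Polynomial.IsRoot, sub_eq_zero] using h1
  · rw [hmem] at h2
    simpa [sub_eq_zero] using h2

theorem nth_root_unique_aux {O : Type*} [CommRing O] [IsDomain O] [CharZero O] (n : ℕ) (hn : 1 ≤ n)
    (a b : O⟦X⟧) (ha : PowerSeries.constantCoeff a = 1) (hb : PowerSeries.constantCoeff b = 1)
    (h : a ^ n = b ^ n) : a = b := by
  have := Commute.mul_geom_sum₂ (Commute.all a b) n
  rw [h, sub_self, mul_eq_zero] at this
  rcases this with h | h
  · exact sub_eq_zero.1 h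
  · exfalso
    have := congrArg PowerSeries.constantCoeff h
    simp [map_sum, ha, hb] at this
    omega
end P6Sec

section CoreSec
open PowerSeries

section Core
variable {O Q Λ : Type*} [CommRing O] [Algebra ℚ O] [IsDomain O] [IsPrincipalIdealRing O] [Field Q] [CharZero Q]
  [Algebra O Q] [IsFractionRing O Q] [Field Λ]

/-- Elements of `Λ` of the form `y / (d X^k)` with `y` a power series over `O`. -/
def bddSubring (φ : Q⟦X⟧ →+* Λ) (O : Type*) [CommRing O] [IsDomain O] [Algebra O Q]
    [FaithfulSMul O Q] : Subring Λ where
  carrier := {x | ∃ (d : O) (k : ℕ) (y : O⟦X⟧), d ≠ 0 ∧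
    φ (PowerSeries.map (algebraMap O Q) (PowerSeries.C d * X ^ k)) * x
      = φ (PowerSeries.map (algebraMap O Q) y)}
  zero_mem' := ⟨1, 0, 0, one_ne_zero, by simp⟩
  one_mem' := ⟨1, 0, 1, one_ne_zero, by simp⟩
  neg_mem' := by
    rintro x ⟨d, k, y, hd, h⟩
    exact ⟨d, k, -y, hd, by rw [mul_neg, h, map_neg, map_neg]⟩
  add_mem' := by
    rintro x x' ⟨d, k, y, hd, h⟩ ⟨d', k', y', hd', h'⟩
    refine ⟨d * d', k + k', PowerSeries.C d' * X ^ k' * y + PowerSeries.C d * X ^ k * y',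
      mul_ne_zero hd hd', ?_⟩
    have : (PowerSeries.C (d * d') * X ^ (k + k') : O⟦X⟧)
      = (PowerSeries.C d * X ^ k) * (PowerSeries.C d' * X ^ k') := by
      rw [map_mul]; ring
    rw [this, map_add (PowerSeries.map _), map_mul (PowerSeries.map _) _ y,
      map_mul (PowerSeries.map _) _ y', map_mul (PowerSeries.map _)
        (PowerSeries.C d * X ^ k) (PowerSeries.C d' * X ^ k'), map_add, map_mul φ, map_mul φ,
        map_mul φ, ← h, ← h']
    ring
  mul_mem' := by
    rintro x x' ⟨d, k, y, hd, h⟩ ⟨d', k', y', hd', h'⟩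
    refine ⟨d * d', k + k', y * y', mul_ne_zero hd hd', ?_⟩
    have : (PowerSeries.C (d * d') * X ^ (k + k') : O⟦X⟧)
      = (PowerSeries.C d * X ^ k) * (PowerSeries.C d' * X ^ k') := by
      rw [map_mul]; ring
    rw [this, map_mul (PowerSeries.map _) y, map_mul (PowerSeries.map _)
        (PowerSeries.C d * X ^ k) (PowerSeries.C d' * X ^ k'), map_mul φ, map_mul φ,
        ← h, ← h']
    ring

theorem core_aux (φ : Q⟦X⟧ →+* Λ) (hφ : Function.Injective φ)
    {A : Type*} [CommRing A] (j : A →+* Λ) (hj : ∀ a, j a ∈ bddSubring φ O)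
    (n : ℕ) (hn : 1 ≤ n) (f : A) (I : Ideal A) (hI : I ^ n = Ideal.span {f})
    (k : ℕ) (l : ℕ) (f0 : Q) (hf0 : f0 ≠ 0) (w : Q⟦X⟧) (hw : PowerSeries.constantCoeff w = 1)
    (hjf : φ (X ^ l) * j f = φ (X ^ k * PowerSeries.C f0 * w ^ n)) :
    ∃ d : O, d ≠ 0 ∧ ∀ i, ∃ y : O, algebraMap O Q d * PowerSeries.coeff i w = algebraMap O Q y := by
  set T := bddSubring φ O with hT
  have hinj : Function.Injective (algebraMap O Q) := IsFractionRing.injective O Q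
  let ι : O⟦X⟧ →+* Q⟦X⟧ := PowerSeries.map (algebraMap O Q)
  have hιinj : Function.Injective ι := PowerSeries.map_injective _ hinj
  have hmemT : ∀ y : O⟦X⟧, φ (ι y) ∈ T := fun y => ⟨1, 0, y, one_ne_zero, by simp [ι]⟩
  let ψ : O⟦X⟧ →+* T := (φ.comp ι).codRestrict T hmemT
  have hψ : ∀ y, ((ψ y : T) : Λ) = φ (ι y) := fun y => rfl
  have hCX : ∀ (d : O) (k : ℕ), d ≠ 0 → φ (ι (PowerSeries.C d * X ^ k)) ≠ 0 := by
    intro d k hd h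
    rw [map_eq_zero_iff φ hφ, map_eq_zero_iff ι hιinj, mul_eq_zero] at h
    rcases h with h | h
    · exact hd (by simpa using congrArg PowerSeries.constantCoeff h)
    · exact PowerSeries.X_prime.ne_zero (eq_zero_of_pow_eq_zero h)
  have hunit : ∀ (d : O) (k : ℕ), d ≠ 0 → IsUnit (ψ (PowerSeries.C d * X ^ k)) := by
    intro d k hd
    refine IsUnit.of_mul_eq_one (⟨(φ (ι (PowerSeries.C d * X ^ k)))⁻¹, d, k, 1, hd, ?_⟩ : T) ?_
    · rw [mul_inv_cancel₀ (hCX d k hd)]; simp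
    · apply Subtype.ext
      exact mul_inv_cancel₀ (hCX d k hd)
  have hrep : ∀ x : T, ∃ (d : O) (k : ℕ) (y : O⟦X⟧), d ≠ 0 ∧
      ψ (PowerSeries.C d * X ^ k) * x = ψ y := by
    rintro ⟨x, d, k, y, hd, h⟩
    exact ⟨d, k, y, hd, Subtype.ext h⟩
  have hPID : IsPrincipalIdealRing T := by
    apply IsPrincipalIdealRing.of_prime
    intro P hP
    have hQ : (P.comap ψ).IsPrime := inferInstance
    have hX : (X : O⟦X⟧) ∉ P.comap ψ := by
      intro h
      apply hP.ne_top
      apply Ideal.eq_top_of_isUnit_mem _ (Ideal.mem_comap.1 h)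
      simpa using hunit 1 1 one_ne_zero
    obtain ⟨c, hc⟩ : ((P.comap ψ).map PowerSeries.constantCoeff).IsPrincipal := inferInstance
    obtain ⟨g, hg⟩ : ∃ g, P.comap ψ = Ideal.span {g} := by
      obtain ⟨T', h1, h2, h3⟩ := PowerSeries.exist_eq_span_eq_ncard_of_X_notMem hX (S := {c}) hc.symm
        (Set.finite_singleton c)
      rw [Set.ncard_singleton, Set.ncard_eq_one] at h3
      obtain ⟨g, rfl⟩ := h3
      exact ⟨g, h1⟩
    refine ⟨ψ g, le_antisymm ?_ ?_⟩
    · intro x hx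
      obtain ⟨d, k, y, hd, h⟩ := hrep x
      have : y ∈ P.comap ψ := by
        rw [Ideal.mem_comap, ← h]; exact P.mul_mem_left _ hx
      rw [hg, Ideal.mem_span_singleton] at this
      obtain ⟨z, rfl⟩ := this
      change x ∈ Ideal.span {ψ g}
      rw [Ideal.mem_span_singleton, ← (hunit d k hd).dvd_mul_left, h, map_mul]
      exact dvd_mul_right _ _
    · change Ideal.span {ψ g} ≤ _
      rw [Ideal.span_singleton_le_iff_mem, ← Ideal.mem_comap, hg]
      exact Ideal.mem_span_singleton_self g
  let jT : A →+* T := j.codRestrict T hj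
  obtain ⟨q, hq⟩ : (I.map jT).IsPrincipal := inferInstance
  change _ = Ideal.span {q} at hq
  have h1 : Ideal.span {q ^ n} = Ideal.span {jT f} := by
    rw [← Ideal.span_singleton_pow, ← hq, ← Ideal.map_pow, hI, Ideal.map_span, Set.image_singleton]
  rw [Ideal.span_singleton_eq_span_singleton] at h1
  obtain ⟨u, hu⟩ := h1
  -- representatives
  obtain ⟨d, a, E, hd, hE⟩ := hrep u
  obtain ⟨d', a', E', hd', hE'⟩ := hrep (u⁻¹ : Tˣ)
  obtain ⟨dq, aq, q1, hdq, hq1⟩ := hrep q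
  have hψinj : Function.Injective ψ := by
    intro x y h
    exact hιinj (hφ (congrArg Subtype.val h))
  have hEE : E * E' = PowerSeries.C (d * d') * X ^ (a + a') := by
    apply hψinj
    rw [map_mul, ← hE, ← hE', mul_mul_mul_comm, Units.mul_inv, mul_one, ← map_mul]
    congr 1
    rw [map_mul]; ring
  obtain ⟨d1, i, ε, hd1, hε, hEeq⟩ := divisor_aux (a + a') (d * d') (mul_ne_zero hd hd') E E' hEE
  have e2 : ((q : T) : Λ) ^ n * ((u : T) : Λ) = j f := congrArg Subtype.val hu
  have e3 : φ (ι (PowerSeries.C d * X ^ a)) * ((u : T) : Λ) = φ (ι E) := congrArg Subtype.val hE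
  have e4 : φ (ι (PowerSeries.C dq * X ^ aq)) * ((q : T) : Λ) = φ (ι q1) := congrArg Subtype.val hq1
  have e5 : ι (PowerSeries.C d * X ^ a) * ι (PowerSeries.C dq * X ^ aq) ^ n *
      (X ^ k * PowerSeries.C f0 * w ^ n) = X ^ l * ι q1 ^ n * ι E := by
    apply hφ
    rw [map_mul φ _ (X ^ k * PowerSeries.C f0 * w ^ n), ← hjf, map_mul φ, map_mul φ, map_mul φ,
      map_pow φ (ι q1), map_pow φ (ι _), ← e4, ← e3, ← e2]
    ring
  have hw0 : w ≠ 0 := by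
    rintro rfl; simp at hw
  have hCne : ∀ {y : Q}, y ≠ 0 → (PowerSeries.C y : Q⟦X⟧) ≠ 0 := by
    intro y hy h
    exact hy (by simpa using congrArg PowerSeries.constantCoeff h)
  have hXne : (X : Q⟦X⟧) ≠ 0 := PowerSeries.X_prime.ne_zero
  have hq0 : q1 ≠ 0 := by
    rintro rfl
    rw [map_zero, zero_pow (by omega), mul_zero, zero_mul] at e5
    have h2 : ∀ (d : O) (k : ℕ), d ≠ 0 → ι (PowerSeries.C d * X ^ k) ≠ 0 := by
      intro d k hd h
      exact hCX d k hd (by rw [h, map_zero])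
    exact (mul_ne_zero (mul_ne_zero (h2 d a hd) (pow_ne_zero _ (h2 dq aq hdq)))
      (mul_ne_zero (mul_ne_zero (pow_ne_zero _ hXne) (hCne hf0)) (pow_ne_zero _ hw0))) e5
  obtain ⟨jj, Q1, hQ1, hQ1'⟩ : ∃ (jj : ℕ) (Q1 : O⟦X⟧), q1 = X ^ jj * Q1 ∧
      PowerSeries.constantCoeff Q1 ≠ 0 := by
    refine ⟨q1.order.toNat, _, (PowerSeries.X_pow_order_mul_divXPowOrder).symm, ?_⟩
    rwa [Ne, PowerSeries.constantCoeff_divXPowOrder_eq_zero_iff]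
  set c := PowerSeries.constantCoeff Q1 with hc
  have hcanc : ∀ (N N' : ℕ) (U V : Q⟦X⟧), PowerSeries.constantCoeff U ≠ 0 →
      PowerSeries.constantCoeff V ≠ 0 → X ^ N * U = X ^ N' * V → U = V := by
    have key : ∀ (N m : ℕ) (U V : Q⟦X⟧), PowerSeries.constantCoeff U ≠ 0 →
      X ^ N * U = X ^ (N + m) * V → U = V := by
      intro N m U V hU h
      rw [pow_add, mul_assoc] at h
      have h := mul_left_cancel₀ (pow_ne_zero _ hXne) h
      rcases m with _ | m
      · simpa using h
      · exfalso; apply hU; rw [h]; simp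
    intro N N' U V hU hV h
    rcases le_total N N' with h1 | h1
    · obtain ⟨m, rfl⟩ := Nat.exists_eq_add_of_le h1
      exact key _ _ _ _ hU h
    · obtain ⟨m, rfl⟩ := Nat.exists_eq_add_of_le h1
      exact (key _ _ _ _ hV h.symm).symm
  have hιX : ι X = X := PowerSeries.map_X _
  have hιC : ∀ y, ι (PowerSeries.C y) = PowerSeries.C (algebraMap O Q y) := PowerSeries.map_C _
  have hιcc : ∀ y, PowerSeries.constantCoeff (ι y) = algebraMap O Q (PowerSeries.constantCoeff y) :=
    fun y => by rw [← PowerSeries.coeff_zero_eq_constantCoeff_apply, ← PowerSeries.coeff_zero_eq_constantCoeff_apply]; exact PowerSeries.coeff_map _ 0 y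
  have hane : ∀ {y : O}, y ≠ 0 → algebraMap O Q y ≠ 0 := by
    intro y hy; rwa [Ne, map_eq_zero_iff _ hinj]
  have hεu : IsUnit (PowerSeries.constantCoeff ε) := hε.map _
  obtain ⟨e, he⟩ := hεu
  have e6 : PowerSeries.C (algebraMap O Q d * algebraMap O Q dq ^ n * f0) * w ^ n =
      PowerSeries.C (algebraMap O Q d1) * ι Q1 ^ n * ι ε := by
    apply hcanc (a + aq * n + k) (l + jj * n + i)
    · simp [hw, hane hd, hf0, hane hdq]
    · simp only [map_mul, map_pow, hιcc, ← he, PowerSeries.constantCoeff_C]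
      exact mul_ne_zero (mul_ne_zero (hane hd1) (pow_ne_zero _ (hane hQ1'))) (hane e.ne_zero)
    · rw [hEeq, hQ1] at e5
      simp only [map_mul, map_pow, hιX, hιC] at e5 ⊢
      calc _ = _ := by ring
        _ = _ := e5
        _ = _ := by ring
  have e7 : algebraMap O Q d * algebraMap O Q dq ^ n * f0 =
      algebraMap O Q d1 * algebraMap O Q c ^ n * algebraMap O Q e := by
    have := congrArg PowerSeries.constantCoeff e6
    simpa [hw, hιcc, ← he, ← hc] using this
  obtain ⟨η, hη, hη1⟩ := nth_root_aux n hn (PowerSeries.C (↑e⁻¹ : O) * ε) (by simp [← he])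
  have hη2 : ε = PowerSeries.C (e : O) * η ^ n := by
    rw [hη, ← mul_assoc, ← map_mul, Units.mul_inv, map_one, one_mul]
  have e8 : w = PowerSeries.C (algebraMap O Q c)⁻¹ * ι (Q1 * η) := by
    apply nth_root_unique_aux n hn _ _ hw
    · simp only [map_mul, hιcc, hη1, ← hc, PowerSeries.constantCoeff_C, map_one, mul_one]
      exact inv_mul_cancel₀ (hane hQ1')
    · rw [e7, hη2] at e6
      have h9 : (PowerSeries.C (algebraMap O Q d1 * algebraMap O Q e) : Q⟦X⟧) ≠ 0 :=
        hCne (mul_ne_zero (hane hd1) (hane e.ne_zero))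
      have h10 : (PowerSeries.C (algebraMap O Q c) : Q⟦X⟧) ^ n ≠ 0 := pow_ne_zero _ (hCne (hane hQ1'))
      apply mul_left_cancel₀ h9
      apply mul_left_cancel₀ h10
      have h11 : (PowerSeries.C (algebraMap O Q c) : Q⟦X⟧) * PowerSeries.C (algebraMap O Q c)⁻¹ = 1 := by
        rw [← map_mul, mul_inv_cancel₀ (hane hQ1'), map_one]
      simp only [map_mul, map_pow, hιC, mul_pow] at e6 ⊢
      calc _ = _ := by ring
        _ = _ := e6
        _ = ((PowerSeries.C (algebraMap O Q c) : Q⟦X⟧) * PowerSeries.C (algebraMap O Q c)⁻¹) ^ n *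
          (PowerSeries.C (algebraMap O Q d1) * ι Q1 ^ n * (PowerSeries.C (algebraMap O Q ↑e) * ι η ^ n)) := by
            rw [h11, one_pow, one_mul]
        _ = _ := by rw [mul_pow]; ring
  refine ⟨c, hQ1', fun i => ⟨PowerSeries.coeff i (Q1 * η), ?_⟩⟩
  rw [e8, PowerSeries.coeff_C_mul, mul_inv_cancel_left₀ (hane hQ1'), PowerSeries.coeff_map]
end Core
end CoreSec

section DomSec
open scoped TensorProduct

theorem point_aux₀ (k E Ω : Type*) [Field k] [Field E] [Algebra k E] [Field Ω] [Algebra k Ω]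
    [IsAlgClosed Ω] [Algebra.FiniteType k E] : Nonempty (E →ₐ[k] Ω) := by
  have := finite_of_finite_type_of_isJacobsonRing k E
  have : Algebra.IsAlgebraic k E := inferInstance
  exact ⟨IsAlgClosed.lift⟩

theorem point_aux₁ (k C Ω : Type*) [Field k] [CommRing C] [Nontrivial C] [Algebra k C] [Field Ω]
    [Algebra k Ω] [IsAlgClosed Ω] [Algebra.FiniteType k C] : Nonempty (C →ₐ[k] Ω) := by
  obtain ⟨m, hm⟩ := Ideal.exists_maximal C
  let : Field (C ⧸ m) := Ideal.Quotient.field m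
  obtain ⟨χ⟩ := point_aux₀ k (C ⧸ m) Ω
  exact ⟨χ.comp (Ideal.Quotient.mkₐ k m)⟩

theorem point_aux (k L Ω : Type*) [Field k] [CommRing L] [Nontrivial L] [Algebra k L] [Field Ω]
    [Algebra k Ω] [IsAlgClosed Ω] (S : Set L) (hS : S.Finite) :
    Nonempty (Algebra.adjoin k S →ₐ[k] Ω) := by
  have : Algebra.FiniteType k (Algebra.adjoin k S) :=
    (Subalgebra.fg_iff_finiteType _).1 (Subalgebra.fg_def.2 ⟨S, hS, rfl⟩)
  exact point_aux₁ k _ Ω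

theorem isDomain_tensor_aux (F F₂ K : Type*) [Field F] [IsAlgClosed F] [Field F₂] [Algebra F F₂]
    [Field K] [Algebra F K] : IsDomain (K ⊗[F] F₂) := by
  have : NoZeroDivisors (K ⊗[F] F₂) := by
    refine ⟨fun {a b} hab => ?_⟩
    by_contra hcon
    push Not at hcon
    obtain ⟨ha, hb⟩ := hcon
    let β := Module.Basis.ofVectorSpace F F₂
    let B := Algebra.TensorProduct.basis K β
    obtain ⟨i, hi⟩ : ∃ i, B.repr a i ≠ 0 := by
      by_contra h; push Not at h
      exact ha (B.repr.map_eq_zero_iff.1 (Finsupp.ext h))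
    obtain ⟨j, hj⟩ : ∃ i, B.repr b i ≠ 0 := by
      by_contra h; push Not at h
      exact hb (B.repr.map_eq_zero_iff.1 (Finsupp.ext h))
    let S : Set K := (B.repr a '' (B.repr a).support) ∪ (B.repr b '' (B.repr b).support) ∪
      {(B.repr a i)⁻¹, (B.repr b j)⁻¹}
    have hS : S.Finite := by
      apply Set.Finite.union
      · exact ((Finset.finite_toSet _).image _).union ((Finset.finite_toSet _).image _)
      · exact Set.toFinite _
    obtain ⟨χ⟩ := point_aux F K F S hS
    let D := Algebra.adjoin F S
    let BD := Algebra.TensorProduct.basis D β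
    have hmem : ∀ x ∈ S, x ∈ D := fun x hx => Algebra.subset_adjoin hx
    have hma : ∀ k, B.repr a k ∈ D := by
      intro k
      by_cases h : B.repr a k = 0
      · rw [h]; exact D.zero_mem
      · exact hmem _ (Or.inl (Or.inl ⟨k, by simpa using h, rfl⟩))
    have hmb : ∀ k, B.repr b k ∈ D := by
      intro k
      by_cases h : B.repr b k = 0
      · rw [h]; exact D.zero_mem
      · exact hmem _ (Or.inl (Or.inr ⟨k, by simpa using h, rfl⟩))
    let ι : D ⊗[F] F₂ →ₐ[F] K ⊗[F] F₂ := Algebra.TensorProduct.map D.val (AlgHom.id F F₂)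
    have hι : Function.Injective ι :=
      Module.Flat.rTensor_preserves_injective_linearMap (M := F₂) D.val.toLinearMap
        Subtype.val_injective
    let ev : D ⊗[F] F₂ →ₐ[F] F₂ :=
      Algebra.TensorProduct.lift ((Algebra.ofId F F₂).comp χ) (AlgHom.id F F₂)
        (fun _ _ => Commute.all _ _)
    have key : ∀ x : K ⊗[F] F₂, (∀ k, B.repr x k ∈ D) → ∀ i, (B.repr x i)⁻¹ ∈ D →
        B.repr x i ≠ 0 → ∃ y : D ⊗[F] F₂, ι y = x ∧ ev y ≠ 0 := by
      intro x hx i hi hne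
      refine ⟨∑ k ∈ (B.repr x).support, (⟨B.repr x k, hx k⟩ : D) ⊗ₜ β k, ?_, ?_⟩
      · conv_rhs => rw [← B.linearCombination_repr x]
        rw [map_sum, Finsupp.linearCombination_apply, Finsupp.sum]
        refine Finset.sum_congr rfl fun k _ => ?_
        simp [ι, B, TensorProduct.smul_tmul']
      · intro h0
        rw [map_sum] at h0
        have h1 : ∑ k ∈ (B.repr x).support, (χ ⟨B.repr x k, hx k⟩) • β k = 0 := by
          rw [← h0]
          refine Finset.sum_congr rfl fun k _ => ?_
          simp [ev, Algebra.ofId_apply, Algebra.smul_def]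
        have h2 := (linearIndependent_iff'.1 β.linearIndependent) _ _ h1 i (by simpa using hne)
        have h3 : (⟨B.repr x i, hx i⟩ : D) * ⟨_, hi⟩ = 1 := Subtype.ext (mul_inv_cancel₀ hne)
        have h4 := congrArg χ h3
        rw [map_mul, h2, zero_mul, map_one] at h4
        exact zero_ne_one h4
    obtain ⟨a', ha', ha''⟩ := key a hma i (hmem _ (Or.inr (by simp))) hi
    obtain ⟨b', hb', hb''⟩ := key b hmb j (hmem _ (Or.inr (by simp))) hj
    have h0 : a' * b' = 0 := hι (by rw [map_mul, ha', hb', hab, map_zero])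
    have := congrArg ev h0
    rw [map_mul, map_zero, mul_eq_zero] at this
    tauto
  exact NoZeroDivisors.to_isDomain _
end DomSec

section NormSec
theorem noether_aux (F E : Type*) [Field F] [Field E] [Algebra F E] [Algebra.EssFiniteType F E]
    (T : Set E) (hT : T.Finite) :
    ∃ (r : ℕ) (g : MvPolynomial (Fin r) F →ₐ[F] E), Function.Injective g ∧
      (∀ t ∈ Algebra.adjoin F T, g.toRingHom.IsIntegralElem t) ∧
      (letI := g.toRingHom.toAlgebra; Algebra.IsAlgebraic (MvPolynomial (Fin r) F) E) := by
  obtain ⟨S, hS⟩ := IntermediateField.fg_top F E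
  set R1 := Algebra.adjoin F ((S : Set E) ∪ T) with hR1
  have : Algebra.FiniteType F R1 :=
    (Subalgebra.fg_iff_finiteType _).1 (Subalgebra.fg_def.2
      ⟨_, (S.finite_toSet.union hT), rfl⟩)
  obtain ⟨r, g, hg, hint⟩ := exists_integral_inj_algHom_of_fg F R1
  have hint' : ∀ t ∈ R1, (R1.val.comp g).toRingHom.IsIntegralElem t := by
    intro t ht
    exact RingHom.IsIntegralElem.map (f := g.toRingHom) (hint ⟨t, ht⟩) R1.val.toRingHom
  refine ⟨r, R1.val.comp g, Subtype.val_injective.comp hg, ?_, ?_⟩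
  · intro t ht
    exact hint' t (Algebra.adjoin_mono Set.subset_union_right ht)
  · letI := (R1.val.comp g).toRingHom.toAlgebra
    have hfs : FaithfulSMul (MvPolynomial (Fin r) F) E :=
      (faithfulSMul_iff_algebraMap_injective _ _).2 (Subtype.val_injective.comp hg)
    refine ⟨fun y => ?_⟩
    have hy : y ∈ IntermediateField.adjoin F (S : Set E) := by rw [hS]; trivial
    rw [IntermediateField.mem_adjoin_iff_div] at hy
    obtain ⟨a, ha, b, hb, rfl⟩ := hy
    have h1 : ∀ c ∈ Algebra.adjoin F (S : Set E), IsAlgebraic (MvPolynomial (Fin r) F) c := by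
      intro c hc
      have : IsIntegral (MvPolynomial (Fin r) F) c :=
        hint' c (Algebra.adjoin_mono Set.subset_union_left hc)
      exact this.isAlgebraic
    rw [div_eq_mul_inv]
    exact (h1 a ha).mul (h1 b hb).inv

theorem normal_of_smooth_aux (R S : Type*) [CommRing R] [IsDomain R] [IsIntegrallyClosed R]
    [CommRing S] [IsDomain S] [Algebra R S] [FaithfulSMul R S] [Algebra.Smooth R S]
    [Algebra.IsIntegral R S] : IsIntegrallyClosed S := by
  let Q := FractionRing R
  let M := Algebra.algebraMapSubmonoid S R⁰
  have hM : M ≤ S⁰ := by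
    rintro _ ⟨x, hx, rfl⟩
    apply mem_nonZeroDivisors_of_ne_zero
    simpa using nonZeroDivisors.ne_zero hx
  have hloc : IsLocalization M (S ⊗[R] Q) := inferInstance
  have hdom : IsDomain (S ⊗[R] Q) := IsLocalization.isDomain_of_le_nonZeroDivisors (R := S) (S := S ⊗[R] Q) (M := M) hM
  have hinj : Function.Injective (algebraMap S (S ⊗[R] Q)) := IsLocalization.injective _ hM
  have hinj' : Function.Injective (algebraMap R (S ⊗[R] Q)) := by
    rw [IsScalarTower.algebraMap_eq R S]
    exact hinj.comp (FaithfulSMul.algebraMap_injective R S)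
  letI : Algebra Q (S ⊗[R] Q) := Algebra.TensorProduct.rightAlgebra
  have hQint : Algebra.IsIntegral Q (S ⊗[R] Q) := by
    refine ⟨fun x => ?_⟩
    induction x with
    | zero => exact isIntegral_zero
    | add x y hx hy => exact hx.add hy
    | tmul x y =>
      have h1 : IsIntegral Q (x ⊗ₜ[R] (1 : Q)) := by
        have h2 := (Algebra.IsIntegral.isIntegral (R := R) x).map
          (Algebra.TensorProduct.includeLeft : S →ₐ[R] S ⊗[R] Q)
        exact h2.tower_top
      have h3 := h1.mul (isIntegral_algebraMap (R := Q) (A := S ⊗[R] Q) (x := y))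
      have h4 : x ⊗ₜ[R] (1 : Q) * algebraMap Q (S ⊗[R] Q) y = x ⊗ₜ y := by
        change x ⊗ₜ[R] (1 : Q) * (1 ⊗ₜ y) = _
        simp
      rwa [h4] at h3
  have hfield : IsField (S ⊗[R] Q) := isField_of_isIntegral_of_isField' (Field.toIsField Q)
  have hfr : IsFractionRing S (S ⊗[R] Q) := by
    letI := hfield.toField
    have : FaithfulSMul S (S ⊗[R] Q) := (faithfulSMul_iff_algebraMap_injective _ _).2 hinj
    refine IsFractionRing.of_field S (S ⊗[R] Q) fun z => ?_
    obtain ⟨⟨x, y⟩, h⟩ := IsLocalization.surj M z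
    refine ⟨x, y, ?_⟩
    have hy : algebraMap S (S ⊗[R] Q) y ≠ 0 := by
      rw [Ne, map_eq_zero_iff _ hinj]
      exact nonZeroDivisors.ne_zero (hM y.2)
    exact (eq_div_iff hy).2 h
  rw [isIntegrallyClosed_iff (S ⊗[R] Q)]
  intro x hx
  obtain ⟨y, hy⟩ := (TensorProduct.toIntegralClosure_bijective_of_smooth (R := R) (S := S) (B := Q)).2
    ⟨x, hx⟩
  have hy' : x = ((TensorProduct.toIntegralClosure R S Q y : integralClosure S (S ⊗[R] Q)) : S ⊗[R] Q) := by
    rw [hy]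
  rw [hy']
  clear hy hy' hx x
  induction y with
  | zero => exact ⟨0, by simp⟩
  | add a b ha hb =>
    obtain ⟨a', ha⟩ := ha
    obtain ⟨b', hb⟩ := hb
    exact ⟨a' + b', by rw [map_add, ha, hb, map_add]; rfl⟩
  | tmul s b =>
    obtain ⟨c, hc⟩ := (IsIntegrallyClosed.isIntegral_iff (R := R) (K := Q)).1 b.2
    refine ⟨c • s, ?_⟩
    change (c • s) ⊗ₜ (1 : Q) = s ⊗ₜ[R] (b : Q)
    rw [← hc, TensorProduct.smul_tmul, Algebra.smul_def, mul_one]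

theorem normal_poly_aux (F K σ L0 : Type*) [Field F] [IsAlgClosed F] [Field K] [Algebra F K]
    [Field L0] [Algebra F L0] [Algebra (MvPolynomial σ F) L0] [IsScalarTower F (MvPolynomial σ F) L0]
    [IsFractionRing (MvPolynomial σ F) L0] : IsIntegrallyClosed (K ⊗[F] L0) := by
  let P := MvPolynomial σ F
  letI : Algebra (K ⊗[F] P) (K ⊗[F] L0) :=
    (Algebra.TensorProduct.map (AlgHom.id K K) (IsScalarTower.toAlgHom F P L0)).toRingHom.toAlgebra
  have hmap : ∀ x, algebraMap (K ⊗[F] P) (K ⊗[F] L0) x =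
    Algebra.TensorProduct.map (AlgHom.id K K) (IsScalarTower.toAlgHom F P L0) x := fun x => rfl
  have : IsScalarTower K (K ⊗[F] P) (K ⊗[F] L0) := by
    refine @IsScalarTower.of_algebraMap_eq K (K ⊗[F] P) (K ⊗[F] L0) _ _ _ _ _ _ fun x => ?_
    rw [hmap]
    simp
  have hloc := IsLocalization.tensorProduct_tensorProduct_right F K (A := P) P⁰ L0 (show RingHom.comp (algebraMap (K ⊗[F] P) (K ⊗[F] L0)) (Algebra.TensorProduct.includeRight (R := F) (A := K) (B := P)).toRingHom = RingHom.comp (Algebra.TensorProduct.includeRight (R := F) (A := K) (B := L0)).toRingHom (algebraMap P L0) by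
    refine RingHom.ext fun x => ?_
    change algebraMap (K ⊗[F] P) (K ⊗[F] L0) (1 ⊗ₜ x) = 1 ⊗ₜ (algebraMap P L0 x)
    rw [hmap]
    simp)
  let e := MvPolynomial.algebraTensorAlgEquiv (σ := σ) F K
  have hdom : IsDomain (K ⊗[F] P) := e.toMulEquiv.isDomain
  have hic : IsIntegrallyClosed (K ⊗[F] P) := IsIntegrallyClosed.of_equiv e.symm.toRingEquiv
  refine isIntegrallyClosed_of_isLocalization (R := K ⊗[F] P) (K ⊗[F] L0) (Submonoid.map Algebra.TensorProduct.includeRight P⁰) ?_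
  rintro _ ⟨x, hx, rfl⟩
  apply mem_nonZeroDivisors_of_ne_zero
  have : Function.Injective (Algebra.TensorProduct.includeRight : P →ₐ[F] K ⊗[F] P) :=
    Algebra.TensorProduct.includeRight_injective (algebraMap F K).injective
  exact (map_ne_zero_iff _ this).2 (nonZeroDivisors.ne_zero hx)

theorem normal_bc_aux (L0 F₂ R : Type*) [Field L0] [Field F₂] [Algebra L0 F₂] [CharZero L0]
    [Module.Finite L0 F₂] [CommRing R] [IsDomain R] [IsIntegrallyClosed R] [Algebra L0 R]
    [IsDomain (R ⊗[L0] F₂)] : IsIntegrallyClosed (R ⊗[L0] F₂) := by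
  have : Algebra.FormallyEtale L0 F₂ := (Algebra.FormallyEtale.iff_isSeparable L0 F₂).2 inferInstance
  have : Algebra.FinitePresentation L0 F₂ := Algebra.FinitePresentation.of_finiteType.1 inferInstance
  have : Algebra.Smooth L0 F₂ := ⟨inferInstance, inferInstance⟩
  have : FaithfulSMul R (R ⊗[L0] F₂) :=
    (faithfulSMul_iff_algebraMap_injective _ _).2
      (Algebra.TensorProduct.includeLeft_injective (S := L0) (algebraMap L0 F₂).injective)
  exact normal_of_smooth_aux R (R ⊗[L0] F₂)

theorem isIntegrallyClosed_tensor_aux (F F₂ K : Type*) [Field F] [IsAlgClosed F] [CharZero F]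
    [Field F₂] [Algebra F F₂] [Algebra.EssFiniteType F F₂]
    [Field K] [Algebra F K] : IsIntegrallyClosed (K ⊗[F] F₂) := by
  obtain ⟨r, g, hg, -, halg⟩ := noether_aux F F₂ ∅ Set.finite_empty
  let P := MvPolynomial (Fin r) F
  letI : Algebra P F₂ := g.toRingHom.toAlgebra
  have : FaithfulSMul P F₂ := (faithfulSMul_iff_algebraMap_injective _ _).2 hg
  let L0 := FractionRing P
  letI : Algebra L0 F₂ := FractionRing.liftAlgebra P F₂
  have : IsScalarTower F P F₂ := IsScalarTower.of_algebraMap_eq fun x => (g.commutes x).symm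
  have : IsScalarTower F L0 F₂ := IsScalarTower.to₁₃₄ F P L0 F₂
  have : Algebra.IsAlgebraic L0 F₂ := (IsFractionRing.comap_isAlgebraic_iff (A := P) (K := L0) (C := F₂)).1 halg
  have : Algebra.EssFiniteType L0 F₂ := Algebra.EssFiniteType.of_comp F L0 F₂
  have : Module.Finite L0 F₂ := Algebra.finite_of_essFiniteType_of_isAlgebraic
  have : CharZero L0 := charZero_of_injective_algebraMap (algebraMap F L0).injective
  have hK : IsIntegrallyClosed (L0 ⊗[F] K) :=
    have := normal_poly_aux F K (Fin r) L0
    IsIntegrallyClosed.of_equiv (Algebra.TensorProduct.comm F K L0).toRingEquiv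
  have hd : IsDomain (L0 ⊗[F] K) := isDomain_tensor_aux F K L0
  have hd2 : IsDomain (F₂ ⊗[F] K) := isDomain_tensor_aux F K F₂
  let e : (L0 ⊗[F] K) ⊗[L0] F₂ ≃ₐ[L0] F₂ ⊗[F] K :=
    (Algebra.TensorProduct.comm L0 _ _).trans
      (Algebra.TensorProduct.cancelBaseChange F L0 L0 F₂ K)
  have hd3 : IsDomain ((L0 ⊗[F] K) ⊗[L0] F₂) := e.toMulEquiv.isDomain
  have := normal_bc_aux L0 F₂ (L0 ⊗[F] K)
  have : IsIntegrallyClosed (F₂ ⊗[F] K) := IsIntegrallyClosed.of_equiv (R := (L0 ⊗[F] K) ⊗[L0] F₂) e.toRingEquiv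
  exact IsIntegrallyClosed.of_equiv (Algebra.TensorProduct.comm F F₂ K).toRingEquiv
end NormSec

section PicRedSec
theorem tpow_aux (R M : Type*) [CommRing R] [AddCommGroup M] [Module R M] [Module.Invertible R M]
    (n : ℕ) : ∃ _ : Module.Invertible R (PiTensorProduct R (fun _ : Fin n => M)),
      CommRing.Pic.mk R (PiTensorProduct R (fun _ : Fin n => M)) = (CommRing.Pic.mk R M) ^ n := by
  induction n with
  | zero =>
    let e : PiTensorProduct R (fun _ : Fin 0 => M) ≃ₗ[R] R := PiTensorProduct.isEmptyEquiv (Fin 0)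
    have h : Module.Invertible R (PiTensorProduct R (fun _ : Fin 0 => M)) := .congr e.symm
    exact ⟨h, by rw [pow_zero]; exact CommRing.Pic.mk_eq_one_iff.2 ⟨e⟩⟩
  | succ n ih =>
    obtain ⟨h1, h2⟩ := ih
    let e1 : PiTensorProduct R (fun _ : Fin 1 => M) ≃ₗ[R] M :=
      PiTensorProduct.subsingletonEquiv (0 : Fin 1)
    have e2 : (PiTensorProduct R (fun _ : Fin n => M)) ⊗[R] (PiTensorProduct R (fun _ : Fin 1 => M)) ≃ₗ[R]
      PiTensorProduct R (fun _ : Fin (n + 1) => M) := TensorPower.mulEquiv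
    let e3 := (TensorProduct.congr (LinearEquiv.refl R (PiTensorProduct R (fun _ : Fin n => M))) e1.symm).trans e2
    have h : Module.Invertible R (PiTensorProduct R (fun _ : Fin (n+1) => M)) := .congr e3
    refine ⟨h, ?_⟩
    rw [pow_succ, ← h2, ← CommRing.Pic.mk_tensor]
    exact (CommRing.Pic.mk_eq_mk_iff.2 ⟨e3⟩).symm

theorem pic_red_aux (R M N : Type*) [CommRing R] [IsDomain R] [AddCommGroup M] [Module R M]
    [AddCommGroup N] [Module R N] (hinv : Nonempty (M ⊗[R] N ≃ₗ[R] R)) (n : ℕ)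
    (hfree : Module.Free R (PiTensorProduct R (fun _ : Fin n => M)))
    (H : ∀ (I : Ideal R) (f : R), I.FG → f ≠ 0 → I ^ n = Ideal.span {f} → ∃ w, I = Ideal.span {w}) :
    Module.Free R M := by
  obtain ⟨e⟩ := hinv
  have : Module.Invertible R M := .left e
  obtain ⟨h1, h2⟩ := tpow_aux R M n
  rw [CommRing.Pic.mk_eq_one_iff_free.2 hfree] at h2
  rw [← CommRing.Pic.mk_eq_one_iff_free]
  let K := FractionRing R
  obtain ⟨c, hc⟩ := (ClassGroup.equivPic R).surjective (CommRing.Pic.mk R M)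
  rw [← hc] at h2 ⊢
  rw [← map_pow, eq_comm, map_eq_one_iff _ (ClassGroup.equivPic R).injective] at h2
  rw [map_eq_one_iff _ (ClassGroup.equivPic R).injective]
  clear hc
  obtain ⟨I, rfl⟩ : ∃ I, ClassGroup.mk K I = c :=
    ClassGroup.induction K (P := fun c => ∃ I, ClassGroup.mk K I = c) (fun I => ⟨I, rfl⟩) c
  rw [← map_pow, ClassGroup.mk_eq_one_iff] at h2
  rw [ClassGroup.mk_eq_one_iff]
  obtain ⟨a, J, ha, hJ⟩ := FractionalIdeal.exists_eq_spanSingleton_mul (I : FractionalIdeal R⁰ K)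
  obtain ⟨x, hx⟩ := h2
  have hx' : ((I : FractionalIdeal R⁰ K)) ^ n = FractionalIdeal.spanSingleton R⁰ x := by
    apply Subtype.coe_injective
    simpa using hx
  have haK : algebraMap R K a ≠ 0 := by simpa using ha
  have hJ2 : (J : FractionalIdeal R⁰ K) = FractionalIdeal.spanSingleton R⁰ (algebraMap R K a) * I := by
    rw [hJ, ← mul_assoc, FractionalIdeal.spanSingleton_mul_spanSingleton, mul_inv_cancel₀ haK,
      FractionalIdeal.spanSingleton_one, one_mul]
  have hJn : (J : FractionalIdeal R⁰ K) ^ n = FractionalIdeal.spanSingleton R⁰ (algebraMap R K a ^ n * x) := by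
    rw [hJ2, mul_pow, hx', FractionalIdeal.spanSingleton_pow, FractionalIdeal.spanSingleton_mul_spanSingleton]
  have hu : IsUnit (FractionalIdeal.spanSingleton R⁰ (algebraMap R K a)) := by
    refine IsUnit.of_mul_eq_one (FractionalIdeal.spanSingleton R⁰ (algebraMap R K a)⁻¹) ?_
    rw [FractionalIdeal.spanSingleton_mul_spanSingleton, mul_inv_cancel₀ haK,
      FractionalIdeal.spanSingleton_one]
  have hJu : IsUnit (J : FractionalIdeal R⁰ K) := by
    rw [hJ2]; exact hu.mul I.isUnit
  obtain ⟨f, hf⟩ : ∃ f, algebraMap R K f = algebraMap R K a ^ n * x := by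
    have : algebraMap R K a ^ n * x ∈ (J : FractionalIdeal R⁰ K) ^ n := by
      rw [hJn]; exact FractionalIdeal.mem_spanSingleton_self _ _
    rw [← FractionalIdeal.coeIdeal_pow] at this
    obtain ⟨f, -, hf⟩ := (FractionalIdeal.mem_coeIdeal _).1 this
    exact ⟨f, hf⟩
  have hJn' : J ^ n = Ideal.span {f} := by
    apply FractionalIdeal.coeIdeal_injective (K := K)
    simp only
    rw [FractionalIdeal.coeIdeal_pow, hJn, FractionalIdeal.coeIdeal_span_singleton, hf]
  have hf0 : f ≠ 0 := by
    rintro rfl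
    have := (hJu.pow n).ne_zero
    rw [← FractionalIdeal.coeIdeal_pow, hJn'] at this
    simp at this
  obtain ⟨w, hw⟩ := H J f (Ideal.fg_of_isUnit (IsFractionRing.injective R K) J hJu) hf0 hJn'
  refine ⟨(algebraMap R K a)⁻¹ * algebraMap R K w, ?_⟩
  have : (I : FractionalIdeal R⁰ K) = FractionalIdeal.spanSingleton R⁰ ((algebraMap R K a)⁻¹ * algebraMap R K w) := by
    rw [hJ, hw, FractionalIdeal.coeIdeal_span_singleton, FractionalIdeal.spanSingleton_mul_spanSingleton]
  rw [this, FractionalIdeal.coe_spanSingleton]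
end PicRedSec

section DescSec
theorem principal_aux {R : Type*} [CommRing R] [IsDomain R] [IsIntegrallyClosed R] (n : ℕ)
    (hn : 1 ≤ n) (I : Ideal R) (f w u : R) (hu : IsUnit u) (hf : f ≠ 0)
    (hI : I ^ n = Ideal.span {f}) (hw : w ^ n = u * f) : I = Ideal.span {w} := by
  have hn0 : n ≠ 0 := by omega
  have hw0 : w ≠ 0 := by
    rintro rfl
    rw [zero_pow hn0] at hw
    exact mul_ne_zero hu.ne_zero hf hw.symm
  have hI' : I ^ n = Ideal.span {w} ^ n := by
    rw [hI, Ideal.span_singleton_pow, hw]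
    exact (Ideal.span_singleton_mul_left_unit hu f).symm
  have hle : I ≤ Ideal.span {w} := by
    intro z hz
    rw [Ideal.mem_span_singleton, ← IsIntegrallyClosed.pow_dvd_pow_iff hn0,
      ← Ideal.mem_span_singleton, ← Ideal.span_singleton_pow, ← hI']
    exact Ideal.pow_mem_pow hz n
  let J : Ideal R := Submodule.comap (LinearMap.mulLeft R w) I
  have hJ : I = Ideal.span {w} * J := by
    apply le_antisymm
    · intro z hz
      obtain ⟨y, rfl⟩ := Ideal.mem_span_singleton.1 (hle hz)
      exact Ideal.mul_mem_mul (Ideal.mem_span_singleton_self w) hz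
    · rw [Ideal.span_singleton_mul_le_iff]
      intro z hz
      exact hz
  have hJn : J ^ n = ⊤ := by
    have h : Ideal.span {w ^ n} * J ^ n = Ideal.span {w ^ n} * ⊤ := by
      rw [← Ideal.span_singleton_pow, ← mul_pow, ← hJ, hI', Ideal.mul_top]
    exact (Ideal.span_singleton_mul_right_inj (pow_ne_zero n hw0)).1 h
  have hJt : J = ⊤ := by
    rw [← top_le_iff, ← hJn]
    exact Ideal.pow_le_self hn0
  rw [hJ, hJt, Ideal.mul_top]

theorem lift_elt_aux (F F₂ K : Type*) [Field F] [Field F₂] [Algebra F F₂] [Field K] [Algebra F K]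
    (x : K ⊗[F] F₂) : ∃ S : Set K, S.Finite ∧ ∀ K0 : IntermediateField F K, S ⊆ K0 →
      x ∈ (Algebra.TensorProduct.map K0.val (AlgHom.id F F₂)).range := by
  induction x with
  | zero => exact ⟨∅, Set.finite_empty, fun K0 _ => zero_mem _⟩
  | tmul a b =>
    refine ⟨{a}, Set.finite_singleton a, fun K0 h => ⟨⟨a, h rfl⟩ ⊗ₜ b, ?_⟩⟩
    simp
  | add x y hx hy =>
    obtain ⟨S, hS, h1⟩ := hx
    obtain ⟨T, hT, h2⟩ := hy
    exact ⟨S ∪ T, hS.union hT, fun K0 h => add_mem (h1 K0 (Set.subset_union_left.trans h))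
      (h2 K0 (Set.subset_union_right.trans h))⟩

theorem lift_set_aux (F F₂ K : Type*) [Field F] [Field F₂] [Algebra F F₂] [Field K] [Algebra F K]
    (T : Set (K ⊗[F] F₂)) (hT : T.Finite) : ∃ K0 : IntermediateField F K, K0.FG ∧
      T ⊆ (Algebra.TensorProduct.map K0.val (AlgHom.id F F₂)).range := by
  choose S hS h using lift_elt_aux F F₂ K
  refine ⟨IntermediateField.adjoin F (⋃ t ∈ T, S t),
    IntermediateField.fg_adjoin_of_finite (hT.biUnion fun t _ => hS t), fun t ht => h t _ ?_⟩
  exact (Set.subset_biUnion_of_mem (u := S) ht).trans (IntermediateField.subset_adjoin F _)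

theorem map_val_injective_aux (F F₂ K : Type*) [Field F] [Field F₂] [Algebra F F₂] [Field K] [Algebra F K]
    (K0 : IntermediateField F K) :
    Function.Injective (Algebra.TensorProduct.map K0.val (AlgHom.id F F₂)) :=
  Module.Flat.rTensor_preserves_injective_linearMap (M := F₂) K0.val.toLinearMap
        Subtype.val_injective

open scoped Pointwise in
theorem span_pow_aux {R : Type*} [CommRing R] (s : Set R) (n : ℕ) :
    Ideal.span s ^ n = Ideal.span (s ^ n) := by
  exact Submodule.span_pow s n

open scoped Pointwise in
theorem descend_aux (F F₂ K : Type*) [Field F] [Field F₂] [Algebra F F₂] [Field K] [Algebra F K]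
    (n : ℕ) (I : Ideal (K ⊗[F] F₂)) (f : K ⊗[F] F₂) (hfg : I.FG) (hf : f ≠ 0)
    (hI : I ^ n = Ideal.span {f}) :
    ∃ (K0 : IntermediateField F K) (I0 : Ideal (K0 ⊗[F] F₂)) (f0 : K0 ⊗[F] F₂), K0.FG ∧ f0 ≠ 0 ∧
      Algebra.TensorProduct.map K0.val (AlgHom.id F F₂) f0 = f ∧ I0 ^ n = Ideal.span {f0} := by
  obtain ⟨s, rfl⟩ := hfg
  rw [span_pow_aux] at hI
  have hdvd : ∀ p ∈ (s : Set (K ⊗[F] F₂)) ^ n, ∃ d, p = f * d := by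
    intro p hp
    have : p ∈ Ideal.span {f} := by rw [← hI]; exact Submodule.subset_span hp
    exact Ideal.mem_span_singleton.1 this
  choose! d hd using hdvd
  have hmem : f ∈ Ideal.span ((s : Set (K ⊗[F] F₂)) ^ n) := by
    rw [hI]; exact Ideal.mem_span_singleton_self f
  have hfin : ((s : Set (K ⊗[F] F₂)) ^ n).Finite := by
    classical
    rw [← Finset.coe_pow]; exact Finset.finite_toSet _
  obtain ⟨c, t, ht, -, hcf⟩ := Submodule.mem_span_iff_exists_finset_subset.1 hmem
  obtain ⟨K0, hK0, hsub⟩ := lift_set_aux F F₂ K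
    ((s : Set (K ⊗[F] F₂)) ∪ {f} ∪ d '' ((s : Set (K ⊗[F] F₂)) ^ n) ∪ c '' t)
    (((s.finite_toSet.union (Set.finite_singleton f)).union (hfin.image d)).union
      (t.finite_toSet.image c))
  have hφ := map_val_injective_aux F F₂ K K0
  set φ := Algebra.TensorProduct.map K0.val (AlgHom.id F F₂) with hφdef
  obtain ⟨f0, hf0⟩ : ∃ f0, φ f0 = f := hsub (by simp)
  have hd0 : ∀ p ∈ (s : Set (K ⊗[F] F₂)) ^ n, ∃ d0, φ d0 = d p := fun p hp =>
    hsub (Or.inl (Or.inr ⟨p, hp, rfl⟩))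
  have hc0 : ∀ p ∈ t, ∃ c0, φ c0 = c p := fun p hp => hsub (Or.inr ⟨p, hp, rfl⟩)
  choose! c0 hc0 using hc0
  let s0 : Set (K0 ⊗[F] F₂) := φ ⁻¹' s
  have hs0 : φ '' s0 = s := Set.image_preimage_eq_of_subset fun x hx =>
    hsub (Or.inl (Or.inl (Or.inl hx)))
  have hs0n : φ '' (s0 ^ n) = (s : Set (K ⊗[F] F₂)) ^ n := by
    rw [Set.image_pow, hs0]
  refine ⟨K0, Ideal.span s0, f0, hK0, ?_, hf0, ?_⟩
  · rintro rfl
    exact hf (by rw [← hf0, map_zero])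
  · refine (span_pow_aux s0 n).trans ?_
    apply le_antisymm
    · rw [Ideal.span_le]
      intro p hp
      have hp' : φ p ∈ (s : Set (K ⊗[F] F₂)) ^ n := by rw [← hs0n]; exact ⟨p, hp, rfl⟩
      obtain ⟨e, he⟩ := hd0 _ hp'
      refine Ideal.mem_span_singleton.2 ⟨e, hφ ?_⟩
      rw [map_mul, hf0, he]
      exact hd _ hp'
    · rw [Ideal.span_singleton_le_iff_mem]
      have hlift : ∀ p ∈ t, ∃ q ∈ s0 ^ n, φ q = p := fun p hp => by
        have := ht hp
        rw [← hs0n] at this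
        exact this
      choose! q hq hqp using hlift
      have : f0 = ∑ p ∈ t, c0 p • q p := by
        apply hφ
        rw [hf0, map_sum, ← hcf]
        refine Finset.sum_congr rfl fun p hp => ?_
        rw [smul_eq_mul, smul_eq_mul, map_mul, hc0 p hp, hqp p hp]
      rw [this]
      exact Submodule.sum_mem _ fun p hp => Submodule.smul_mem _ _ (Submodule.subset_span (hq p hp))
end DescSec

section SolSec
section Sol
variable {F F₂ : Type*} [Field F] [Field F₂] [Algebra F F₂]

theorem bc_comp_aux {A B C : Type*} [CommRing A] [Algebra F A] [CommRing B] [Algebra F B]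
    [CommRing C] [Algebra F C] (φ : A →ₐ[F] B) (ψ : B →ₐ[F] C) (x : A ⊗[F] F₂) :
    Algebra.TensorProduct.map ψ (AlgHom.id F F₂) (Algebra.TensorProduct.map φ (AlgHom.id F F₂) x) =
    Algebra.TensorProduct.map (ψ.comp φ) (AlgHom.id F F₂) x := by
  induction x with
  | zero => simp
  | tmul a b => simp
  | add x y hx hy => simp only [map_add, hx, hy]

theorem bc_inj_aux {A B : Type*} [CommRing A] [Algebra F A] [CommRing B] [Algebra F B]
    (φ : A →ₐ[F] B) (h : Function.Injective φ) :
    Function.Injective (Algebra.TensorProduct.map φ (AlgHom.id F F₂)) :=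
  Module.Flat.rTensor_preserves_injective_linearMap (M := F₂) φ.toLinearMap h

theorem lift_adj_aux {k E : Type*} [Field k] [Algebra F k] [CommRing E] [Algebra k E] [Algebra F E]
    [IsScalarTower F k E] (x : E ⊗[F] F₂) : ∃ S : Set E, S.Finite ∧ ∀ D : Subalgebra k E, S ⊆ D →
      ∃ y, Algebra.TensorProduct.map (D.val.restrictScalars F) (AlgHom.id F F₂) y = x := by
  induction x with
  | zero => exact ⟨∅, Set.finite_empty, fun D _ => ⟨0, map_zero _⟩⟩
  | tmul a b =>
    refine ⟨{a}, Set.finite_singleton a, fun D h => ⟨⟨a, h rfl⟩ ⊗ₜ b, ?_⟩⟩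
    simp
  | add x y hx hy =>
    obtain ⟨S, hS, h1⟩ := hx
    obtain ⟨T, hT, h2⟩ := hy
    refine ⟨S ∪ T, hS.union hT, fun D h => ?_⟩
    obtain ⟨a, ha⟩ := h1 D (Set.subset_union_left.trans h)
    obtain ⟨b, hb⟩ := h2 D (Set.subset_union_right.trans h)
    exact ⟨a + b, by rw [map_add, ha, hb]⟩

theorem specialize_aux {k E Ω : Type*} [Field k] [Algebra F k] [Field E] [Algebra k E]
    [Algebra F E] [IsScalarTower F k E] [Field Ω] [Algebra k Ω] [Algebra F Ω] [IsScalarTower F k Ω]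
    [IsAlgClosed Ω] (f : k ⊗[F] F₂) (n : ℕ) (w : E ⊗[F] F₂) (e : E) (he : e ≠ 0) (g : F₂)
    (hw : w ^ n = (e ⊗ₜ g) *
      Algebra.TensorProduct.map (IsScalarTower.toAlgHom F k E) (AlgHom.id F F₂) f) :
    ∃ (w : Ω ⊗[F] F₂) (e : Ω), e ≠ 0 ∧ w ^ n = (e ⊗ₜ g) *
      Algebra.TensorProduct.map (IsScalarTower.toAlgHom F k Ω) (AlgHom.id F F₂) f := by
  obtain ⟨S, hS, hlift⟩ := lift_adj_aux (k := k) w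
  let T := S ∪ {e, e⁻¹}
  have hT : T.Finite := hS.union (Set.toFinite _)
  obtain ⟨χ⟩ := point_aux k E Ω T hT
  let D := Algebra.adjoin k T
  have hTD : T ⊆ D := Algebra.subset_adjoin
  obtain ⟨y, hy⟩ := hlift D (Set.subset_union_left.trans hTD)
  let e' : D := ⟨e, hTD (by simp [T])⟩
  let e'' : D := ⟨e⁻¹, hTD (by simp [T])⟩
  have hee : e' * e'' = 1 := Subtype.ext (mul_inv_cancel₀ he)
  have hinj := bc_inj_aux (F₂ := F₂) (D.val.restrictScalars F) Subtype.val_injective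
  let ι : k →ₐ[F] D := (Algebra.ofId k D).restrictScalars F
  have h1 : y ^ n = (e' ⊗ₜ g) * Algebra.TensorProduct.map ι (AlgHom.id F F₂) f := by
    apply hinj
    rw [map_pow, hy, map_mul, bc_comp_aux, hw]
    congr 1
  let χ' : D →ₐ[F] Ω := χ.restrictScalars F
  refine ⟨Algebra.TensorProduct.map χ' (AlgHom.id F F₂) y, χ e', ?_, ?_⟩
  · intro h0
    have := congrArg χ hee
    rw [map_mul, h0, zero_mul, map_one] at this
    exact zero_ne_one this
  · rw [← map_pow, h1, map_mul, bc_comp_aux]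
    congr 1
    congr 2
    ext x
    exact χ.commutes x

theorem root_unity_aux {Ω A : Type*} [Field Ω] [IsAlgClosed Ω] [CharZero Ω] [CommRing A] [IsDomain A]
    [Algebra Ω A] (n : ℕ) (hn : 1 ≤ n) (a b : A) (h : a ^ n = b ^ n) : ∃ ρ : Ω, a = ρ • b := by
  have : NeZero n := ⟨by omega⟩
  obtain ⟨ζ, hζ⟩ := HasEnoughRootsOfUnity.exists_primitiveRoot Ω n
  have hζ' : IsPrimitiveRoot (algebraMap Ω A ζ) n := hζ.map_of_injective (FaithfulSMul.algebraMap_injective Ω A)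
  have := hζ'.pow_sub_pow_eq_prod_sub_mul a b (by omega)
  rw [h, sub_self, eq_comm, Finset.prod_eq_zero_iff] at this
  obtain ⟨μ, hμ, h0⟩ := this
  rw [Polynomial.mem_nthRootsFinset (by omega)] at hμ
  obtain ⟨i, -, hi⟩ := hζ'.eq_pow_of_pow_eq_one hμ
  refine ⟨ζ ^ i, ?_⟩
  rw [Algebra.smul_def, map_pow, hi]
  exact sub_eq_zero.1 h0

theorem solve_aux [IsAlgClosed F] [CharZero F] {k E : Type*} [Field k] [Algebra F k] [Field E]
    (ψ : k →+* E)
    [Algebra F E] (hψ : ∀ x, ψ (algebraMap F k x) = algebraMap F E x)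
    (f : k ⊗[F] F₂) (hf : f ≠ 0) (n : ℕ) (hn : 1 ≤ n) (w : E ⊗[F] F₂) (e : E) (he : e ≠ 0) (g : F₂)
    (hg : g ≠ 0) (hw : w ^ n = (e ⊗ₜ g) *
      Algebra.TensorProduct.map (⟨ψ, hψ⟩ : k →ₐ[F] E) (AlgHom.id F F₂) f) :
    ∃ (w : k ⊗[F] F₂) (e : k), e ≠ 0 ∧ w ^ n = (e ⊗ₜ g) * f := by
  letI := ψ.toAlgebra
  have : IsScalarTower F k E := IsScalarTower.of_algebraMap_eq fun x => (hψ x).symm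
  let Ω := AlgebraicClosure k
  have : CharZero k := charZero_of_injective_algebraMap (algebraMap F k).injective
  have : CharZero Ω := charZero_of_injective_algebraMap (algebraMap k Ω).injective
  have : IsDomain (Ω ⊗[F] F₂) := isDomain_tensor_aux F F₂ Ω
  obtain ⟨w1, e1, he1, hw1⟩ := specialize_aux (Ω := Ω) f n w e he g hw
  let Φ := Algebra.TensorProduct.map (IsScalarTower.toAlgHom F k Ω) (AlgHom.id F F₂)
  have hΦ : Function.Injective Φ := bc_inj_aux _ (algebraMap k Ω).injective
  let β := Module.Basis.ofVectorSpace F F₂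
  let B := Algebra.TensorProduct.basis Ω β
  have hfΦ : Φ f ≠ 0 := by rwa [Ne, map_eq_zero_iff _ hΦ]
  have htm : ∀ x : Ω, x ≠ 0 → x ⊗ₜ[F] g ≠ 0 := by
    intro x hx h0
    have h1 : (x⁻¹ ⊗ₜ[F] g⁻¹) * (x ⊗ₜ[F] g) = 1 := by
      rw [Algebra.TensorProduct.tmul_mul_tmul, inv_mul_cancel₀ hx, inv_mul_cancel₀ hg]; rfl
    rw [h0, mul_zero] at h1
    exact zero_ne_one h1
  have hw10 : w1 ≠ 0 := by
    rintro rfl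
    rw [zero_pow (by omega)] at hw1
    exact mul_ne_zero (htm e1 he1) hfΦ hw1.symm
  obtain ⟨m, hm⟩ : ∃ i, B.repr w1 i ≠ 0 := by
    by_contra h; push Not at h
    exact hw10 (B.repr.map_eq_zero_iff.1 (Finsupp.ext h))
  set c := B.repr w1 m
  let w2 := c⁻¹ • w1
  let e2 := c⁻¹ ^ n * e1
  have he2 : e2 ≠ 0 := mul_ne_zero (pow_ne_zero _ (inv_ne_zero hm)) he1
  have hw2 : w2 ^ n = (e2 ⊗ₜ g) * Φ f := by
    simp only [w2, e2]
    rw [smul_pow, hw1, ← smul_eq_mul (a := c⁻¹ ^ n), ← TensorProduct.smul_tmul', smul_mul_assoc]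
  have hm2 : B.repr w2 m = 1 := by
    simp only [w2, map_smul, Finsupp.smul_apply, smul_eq_mul]
    exact inv_mul_cancel₀ hm
  have hw20 : w2 ≠ 0 := by
    intro h; rw [h] at hm2; simp at hm2
  have hrepr : ∀ (σ : Ω ≃ₐ[k] Ω) (x : Ω ⊗[F] F₂) i,
      B.repr (Algebra.TensorProduct.map (σ.toAlgHom.restrictScalars F) (AlgHom.id F F₂) x) i =
        σ (B.repr x i) := by
    intro σ x i
    induction x with
    | zero => simp
    | tmul a b => 
      have h : σ (algebraMap F Ω (β.repr b i)) = algebraMap F Ω (β.repr b i) :=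
        (σ.toAlgHom.restrictScalars F).commutes _
      simp [B, Algebra.TensorProduct.basis_repr_tmul, Algebra.smul_def, h]
    | add x y hx hy => simp only [map_add, Finsupp.add_apply, hx, hy]
  have hσ : ∀ σ : Ω ≃ₐ[k] Ω,
      Algebra.TensorProduct.map (σ.toAlgHom.restrictScalars F) (AlgHom.id F F₂) w2 = w2 ∧
        σ e2 = e2 := by
    intro σ
    set Sg := Algebra.TensorProduct.map (σ.toAlgHom.restrictScalars F) (AlgHom.id F F₂)
    have h1 : (Sg w2) ^ n = (σ e2 ⊗ₜ g) * Φ f := by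
      rw [← map_pow, hw2, map_mul]
      congr 1
      simp only [Sg, Φ]
      rw [bc_comp_aux]
      congr 2
      ext x
      exact σ.commutes x
    obtain ⟨ρ, hρ⟩ := IsAlgClosed.exists_pow_nat_eq (σ e2 * e2⁻¹) (n := n) (by omega)
    have h2 : (Sg w2) ^ n = (ρ • w2) ^ n := by
      rw [h1, smul_pow, hw2, hρ, ← smul_mul_assoc, TensorProduct.smul_tmul', smul_eq_mul,
        mul_assoc, inv_mul_cancel₀ he2, mul_one]
    obtain ⟨ρ', hρ'⟩ := root_unity_aux (Ω := Ω) n hn _ _ h2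
    have h3 := hrepr σ w2 m
    rw [hm2, map_one, hρ', smul_smul, map_smul, Finsupp.smul_apply, hm2, smul_eq_mul, mul_one] at h3
    rw [smul_smul, h3, one_smul] at hρ'
    refine ⟨hρ', ?_⟩
    rw [hρ', hw2] at h1
    have h4 := mul_right_cancel₀ hfΦ h1
    by_contra hne
    refine htm _ (sub_ne_zero.2 hne) ?_
    rw [TensorProduct.sub_tmul, h4, sub_self]
  have hfix : ∀ x : Ω, (∀ σ : Ω ≃ₐ[k] Ω, σ x = x) → ∃ y, algebraMap k Ω y = x := by
    intro x hx
    have := (InfiniteGalois.mem_bot_iff_fixed (k := k) (K := Ω) x).2 hx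
    exact this
  obtain ⟨e3, he3⟩ := hfix e2 fun σ => (hσ σ).2
  have hco : ∀ i, ∃ y, algebraMap k Ω y = B.repr w2 i := fun i => hfix _ fun σ => by
    rw [← hrepr, (hσ σ).1]
  choose y hy using hco
  refine ⟨∑ i ∈ (B.repr w2).support, y i ⊗ₜ β i, e3, ?_, ?_⟩
  · rintro rfl
    exact he2 (by rw [← he3, map_zero])
  · have h5 : Φ (∑ i ∈ (B.repr w2).support, y i ⊗ₜ β i) = w2 := by
      conv_rhs => rw [← B.linearCombination_repr w2]
      rw [map_sum, Finsupp.linearCombination_apply, Finsupp.sum]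
      refine Finset.sum_congr rfl fun i _ => ?_
      simp [Φ, B, TensorProduct.smul_tmul', hy]
    apply hΦ
    rw [map_pow, h5, hw2, map_mul]
    congr 1
    simp [Φ, he3]

end Sol
end SolSec

section Emb1Sec
open PowerSeries in
theorem exp_indep_aux (F : Type*) [Field F] [CharZero F] [Algebra ℚ F] :
    LinearIndependent F (fun μ : F => PowerSeries.rescale μ (PowerSeries.exp F)) := by
  refine Module.End.eigenvectors_linearIndependent' (PowerSeries.derivative F).toLinearMap
    (fun μ : F => μ) (fun _ _ h => h) _ fun μ => ⟨?_, ?_⟩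
  · rw [Module.End.mem_eigenspace_iff]
    ext n
    rw [PowerSeries.coeff_smul]
    change PowerSeries.coeff n (PowerSeries.derivative F _) = _
    rw [PowerSeries.coeff_derivative, PowerSeries.coeff_rescale, PowerSeries.coeff_rescale,
      PowerSeries.coeff_exp, PowerSeries.coeff_exp]
    have h : (algebraMap ℚ F) (1 / ((n + 1).factorial : ℚ)) * ((n : F) + 1) =
        algebraMap ℚ F (1 / (n.factorial : ℚ)) := by
      have : ((n : F) + 1) = algebraMap ℚ F (n + 1) := by simp
      rw [this, ← map_mul, Nat.factorial_succ]
      congr 1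
      have := n.factorial_pos
      push_cast
      field_simp
    rw [mul_assoc, h, smul_eq_mul, pow_succ]
    ring
  · intro h
    have := congrArg PowerSeries.constantCoeff h
    rw [← PowerSeries.coeff_zero_eq_constantCoeff, PowerSeries.coeff_rescale] at this
    simp at this

theorem exists_indep_aux (F : Type*) [Field F] [IsAlgClosed F] [CharZero F] (r : ℕ) :
    ∃ c : Fin r → F, Function.Injective (fun m : Fin r →₀ ℕ => m.sum fun i k => (k : F) * c i) := by
  obtain ⟨p, hp, hpr⟩ := Nat.exists_infinite_primes (r + 1)
  have : NeZero p := ⟨hpr.ne_zero⟩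
  obtain ⟨ζ, hζ⟩ := HasEnoughRootsOfUnity.exists_primitiveRoot F p
  have hdeg : (minpoly ℚ ζ).natDegree = p - 1 := by
    rw [← Polynomial.cyclotomic_eq_minpoly_rat hζ hpr.pos, Polynomial.natDegree_cyclotomic,
      Nat.totient_prime hpr]
  have hli := linearIndependent_pow (K := ℚ) ζ
  have hr : r ≤ (minpoly ℚ ζ).natDegree := by omega
  have hli2 : LinearIndependent ℚ (fun i : Fin r => ζ ^ (i : ℕ)) :=
    hli.comp (Fin.castLE hr) (Fin.castLE_injective hr)
  refine ⟨fun i => ζ ^ (i : ℕ), fun m m' h => ?_⟩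
  simp only at h
  rw [Finsupp.sum_fintype _ _ (by simp), Finsupp.sum_fintype _ _ (by simp)] at h
  have h2 : ∑ i, ((m i : ℚ) - m' i) • ζ ^ (i : ℕ) = 0 := by
    simp only [Algebra.smul_def, map_sub, map_natCast, sub_mul, Finset.sum_sub_distrib]
    exact sub_eq_zero.2 h
  ext i
  have := Fintype.linearIndependent_iff.1 hli2 _ h2 i
  exact_mod_cast sub_eq_zero.1 this

theorem poly_embed_aux (F : Type*) [Field F] [IsAlgClosed F] [CharZero F] (r : ℕ) (a : Fin r → F) :
    ∃ h : MvPolynomial (Fin r) F →ₐ[F] PowerSeries F, Function.Injective h ∧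
      ∀ p, PowerSeries.constantCoeff (h p) = MvPolynomial.eval a p := by
  letI : Algebra ℚ F := DivisionRing.toRatAlgebra
  obtain ⟨c, hc⟩ := exists_indep_aux F r
  let E : Fin r → PowerSeries F := fun i => PowerSeries.rescale (c i) (PowerSeries.exp F)
  let h0 : MvPolynomial (Fin r) F →ₐ[F] PowerSeries F := MvPolynomial.aeval E
  have hmon : ∀ m : Fin r →₀ ℕ, (m.prod fun i k => E i ^ k) =
      PowerSeries.rescale (m.sum fun i k => (k : F) * c i) (PowerSeries.exp F) := by
    intro m
    have hE : ∀ i (k : ℕ), E i ^ k = PowerSeries.rescale ((k : F) * c i) (PowerSeries.exp F) := by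
      intro i k
      induction k with
      | zero => ext n; rw [PowerSeries.coeff_rescale]; rcases n with _ | n <;> simp [PowerSeries.coeff_one]
      | succ k ih =>
        rw [pow_succ, ih, PowerSeries.exp_mul_exp_eq_exp_add]
        congr 2
        push_cast; ring
    rw [Finsupp.prod_fintype _ _ (by simp), Finsupp.sum_fintype _ _ (by simp)]
    simp only [hE]
    generalize (Finset.univ : Finset (Fin r)) = s
    classical
    induction s using Finset.induction_on with
    | empty => ext n; rw [PowerSeries.coeff_rescale]; rcases n with _ | n <;> simp [PowerSeries.coeff_one]
    | insert i s hi ih => rw [Finset.prod_insert hi, Finset.sum_insert hi, ih, PowerSeries.exp_mul_exp_eq_exp_add]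
  have hinj0 : Function.Injective h0 := by
    rw [injective_iff_map_eq_zero]
    intro p hp
    have hli := (exp_indep_aux F).comp _ hc
    have h1 : ∑ m ∈ p.support, p.coeff m • PowerSeries.rescale (m.sum fun i k => (k : F) * c i) (PowerSeries.exp F) = 0 := by
      rw [← hp]
      simp only [h0]
      rw [MvPolynomial.aeval_def, MvPolynomial.eval₂_eq]
      refine Finset.sum_congr rfl fun m _ => ?_
      rw [← hmon, Algebra.smul_def, Finsupp.prod_fintype _ _ (by simp),
        Finset.prod_subset (Finset.subset_univ m.support)]
      intro i _ hi
      simp [Finsupp.notMem_support_iff.1 hi]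
    have h2 := linearIndependent_iff'.1 hli _ _ h1
    ext m
    rw [MvPolynomial.coeff_zero]
    by_contra h3
    exact h3 (h2 m (MvPolynomial.mem_support_iff.2 h3))
  let sh : MvPolynomial (Fin r) F →ₐ[F] MvPolynomial (Fin r) F :=
    MvPolynomial.aeval fun i => MvPolynomial.X i + MvPolynomial.C (a i - 1)
  let sh' : MvPolynomial (Fin r) F →ₐ[F] MvPolynomial (Fin r) F :=
    MvPolynomial.aeval fun i => MvPolynomial.X i - MvPolynomial.C (a i - 1)
  have hsh : sh'.comp sh = AlgHom.id F _ := by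
    ext i
    simp [sh, sh']
  have hshinj : Function.Injective sh := by
    refine Function.LeftInverse.injective (g := sh') fun x => ?_
    exact DFunLike.congr_fun hsh x
  refine ⟨h0.comp sh, hinj0.comp hshinj, fun p => ?_⟩
  have : (PowerSeries.constantCoeff (R := F)).comp (h0.comp sh).toRingHom = MvPolynomial.eval a := by
    apply MvPolynomial.ringHom_ext
    · intro x
      simp [h0, sh, PowerSeries.algebraMap_apply]
    · intro i
      simp only [RingHom.comp_apply, AlgHom.toRingHom_eq_coe, RingHom.coe_coe, AlgHom.comp_apply, sh, h0]
      have : PowerSeries.constantCoeff (E i) = 1 := by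
        rw [← PowerSeries.coeff_zero_eq_constantCoeff_apply, PowerSeries.coeff_rescale]; simp
      simp [this, PowerSeries.algebraMap_apply]
  exact DFunLike.congr_fun this p
end Emb1Sec

section Emb2Sec
theorem hensel_aux (F : Type*) [Field F] (p : Polynomial (PowerSeries F)) (hp : p.Monic) (b : F)
    (h1 : PowerSeries.constantCoeff (p.eval (PowerSeries.C b)) = 0)
    (h2 : PowerSeries.constantCoeff (p.derivative.eval (PowerSeries.C b)) ≠ 0) :
    ∃ τ, p.IsRoot τ := by
  obtain ⟨τ, hτ, -⟩ := HenselianRing.is_henselian (R := PowerSeries F) (I := Ideal.span {PowerSeries.X}) p hp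
    (PowerSeries.C b) (by
      rw [Ideal.mem_span_singleton, PowerSeries.X_dvd_iff]; exact h1) (by
      apply IsUnit.map
      rw [PowerSeries.isUnit_iff_constantCoeff]
      exact isUnit_iff_ne_zero.2 h2)
  exact ⟨τ, hτ⟩

theorem embed_aux (F K0 E : Type*) [Field F] [IsAlgClosed F] [CharZero F] [Field K0] [Algebra F K0]
    [Algebra.EssFiniteType F K0] [Field E] (j : PowerSeries F →+* E) (hj : Function.Injective j) :
    ∃ ψ : K0 →+* E, ∀ x : F, ψ (algebraMap F K0 x) = j (PowerSeries.C x) := by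
  obtain ⟨r, g, hg, -, halg⟩ := noether_aux F K0 ∅ Set.finite_empty
  let P := MvPolynomial (Fin r) F
  letI : Algebra P K0 := g.toRingHom.toAlgebra
  have hfaith : FaithfulSMul P K0 := (faithfulSMul_iff_algebraMap_injective _ _).2 hg
  let L0 := FractionRing P
  letI : Algebra L0 K0 := FractionRing.liftAlgebra P K0
  have : IsScalarTower F P K0 := IsScalarTower.of_algebraMap_eq fun x => (g.commutes x).symm
  have : IsScalarTower F L0 K0 := IsScalarTower.to₁₃₄ F P L0 K0
  have : Algebra.IsAlgebraic L0 K0 := (IsFractionRing.comap_isAlgebraic_iff (A := P) (K := L0) (C := K0)).1 halg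
  have : Algebra.EssFiniteType L0 K0 := Algebra.EssFiniteType.of_comp F L0 K0
  have : Module.Finite L0 K0 := Algebra.finite_of_essFiniteType_of_isAlgebraic
  have : CharZero L0 := charZero_of_injective_algebraMap (algebraMap F L0).injective
  obtain ⟨θ0, hθ0⟩ := Field.exists_primitive_element L0 K0
  obtain ⟨d, hd, hdint⟩ := (halg.isAlgebraic θ0).exists_integral_multiple
  let θ : K0 := d • θ0
  have hdL : algebraMap P L0 d ≠ 0 := by
    rw [Ne, map_eq_zero_iff _ (IsFractionRing.injective P L0)]; exact hd
  have hθ : IsIntegral P θ := hdint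
  have hθL : IsIntegral L0 θ := hθ.tower_top
  have hprim : Algebra.adjoin L0 {θ} = ⊤ := by
    rw [← IntermediateField.adjoin_simple_toSubalgebra_of_isAlgebraic hθL.isAlgebraic]
    have h1 : IntermediateField.adjoin L0 {θ} = ⊤ := by
      rw [← top_le_iff, ← hθ0, IntermediateField.adjoin_simple_le_iff]
      have h2 : θ0 = (algebraMap P L0 d)⁻¹ • θ := by
        simp only [θ]
        rw [← IsScalarTower.algebraMap_smul L0 d θ0, smul_smul, inv_mul_cancel₀ hdL, one_smul]
      rw [h2]
      exact IntermediateField.smul_mem _ (IntermediateField.mem_adjoin_simple_self L0 θ)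
    rw [h1]; rfl
  let p := minpoly P θ
  have hpL : minpoly L0 θ = p.map (algebraMap P L0) := minpoly.isIntegrallyClosed_eq_field_fractions' L0 hθ
  have hder : Polynomial.aeval θ p.derivative ≠ 0 := by
    have hsep : (minpoly L0 θ).Separable := Algebra.IsSeparable.isSeparable L0 θ
    have := hsep.aeval_derivative_ne_zero (minpoly.aeval L0 θ)
    rwa [hpL, Polynomial.derivative_map, Polynomial.aeval_map_algebraMap] at this
  -- the point
  let S : Set K0 := Set.range (fun i => g (MvPolynomial.X i)) ∪ {θ, (Polynomial.aeval θ p.derivative)⁻¹}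
  have hS : S.Finite := (Set.finite_range _).union (Set.toFinite _)
  obtain ⟨χ⟩ := point_aux F K0 F S hS
  let D := Algebra.adjoin F S
  have hSD : S ⊆ D := Algebra.subset_adjoin
  let a : Fin r → F := fun i => χ ⟨g (MvPolynomial.X i), hSD (Or.inl ⟨i, rfl⟩)⟩
  let θD : D := ⟨θ, hSD (by simp [S])⟩
  let δD : D := ⟨(Polynomial.aeval θ p.derivative)⁻¹, hSD (by simp [S])⟩
  let gD : P →ₐ[F] D := MvPolynomial.aeval fun i => ⟨g (MvPolynomial.X i), hSD (Or.inl ⟨i, rfl⟩)⟩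
  have hgD : ∀ x, (gD x : K0) = g x := by
    intro x
    have : D.val.comp gD = g := by
      ext i; simp [gD]
    exact DFunLike.congr_fun this x
  have hχ : ∀ x, χ (gD x) = MvPolynomial.eval a x := by
    intro x
    have : (χ.comp gD) = MvPolynomial.aeval a := by
      ext i; simp [gD, a]
    rw [← AlgHom.comp_apply, this]; rfl
  have hpe : ∀ q : Polynomial P, ((q.eval₂ gD.toRingHom θD : D) : K0) = Polynomial.aeval θ q := by
    intro q
    change D.val.toRingHom _ = _
    rw [Polynomial.hom_eval₂, Polynomial.aeval_def]
    congr 1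
    exact RingHom.ext hgD
  have hpχ : ∀ q : Polynomial P, q.eval₂ (MvPolynomial.eval a) (χ θD) = χ (q.eval₂ gD.toRingHom θD) := by
    intro q
    change _ = χ.toRingHom _
    rw [Polynomial.hom_eval₂]
    congr 1
    exact RingHom.ext fun x => (hχ x).symm
  obtain ⟨h, hinj, hcc⟩ := poly_embed_aux F r a
  have hce : ∀ q : Polynomial P, PowerSeries.constantCoeff ((q.map h.toRingHom).eval (PowerSeries.C (χ θD))) =
      χ (q.eval₂ gD.toRingHom θD) := by
    intro q
    rw [← hpχ, Polynomial.eval_map, Polynomial.hom_eval₂]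
    congr 1
    · exact RingHom.ext hcc
  obtain ⟨τ, hτ⟩ := hensel_aux F (p.map h.toRingHom) ((minpoly.monic hθ).map _) (χ θD) (by
      rw [hce]
      have : p.eval₂ gD.toRingHom θD = 0 := Subtype.ext (by rw [hpe]; exact minpoly.aeval P θ)
      rw [this, map_zero]) (by
      rw [Polynomial.derivative_map, hce]
      intro h0
      have : (p.derivative.eval₂ gD.toRingHom θD) * δD = 1 := Subtype.ext (by
        change ((p.derivative.eval₂ gD.toRingHom θD : D) : K0) * _ = 1
        rw [hpe]
        exact mul_inv_cancel₀ hder)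
      have := congrArg χ this
      rw [map_mul, h0, zero_mul, map_one] at this
      exact zero_ne_one this)
  have hjh : Function.Injective (j.comp h.toRingHom) := hj.comp hinj
  let ψ0 : L0 →+* E := IsFractionRing.lift (A := P) (g := j.comp h.toRingHom) hjh
  have hψ0 : ∀ x : P, ψ0 (algebraMap P L0 x) = j (h x) := fun x => IsFractionRing.lift_algebraMap hjh x
  letI : Algebra L0 E := ψ0.toAlgebra
  let pb := PowerBasis.ofAdjoinEqTop hθL hprim
  have hgen : pb.gen = θ := PowerBasis.ofAdjoinEqTop_gen hθL hprim
  let ψ := pb.lift (j τ) (by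
    rw [hgen, hpL, Polynomial.aeval_def, Polynomial.eval₂_map]
    have h5 : (algebraMap L0 E).comp (algebraMap P L0) = j.comp h.toRingHom := RingHom.ext hψ0
    rw [h5, ← Polynomial.eval₂_map, Polynomial.eval₂_hom, hτ.eq_zero, map_zero])
  refine ⟨ψ.toRingHom, fun x => ?_⟩
  have h6 : algebraMap F K0 x = algebraMap L0 K0 (algebraMap P L0 (MvPolynomial.C x)) := by
    rw [IsScalarTower.algebraMap_apply F L0 K0]
    congr 1
  rw [h6]
  change ψ _ = _
  rw [ψ.commutes]
  change ψ0 _ = _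
  rw [hψ0]
  congr 1
  exact h.commutes x
end Emb2Sec

section Val1Sec
noncomputable def degVal (F : Type*) [Field F] (r : ℕ) :
    Valuation (MvPolynomial (Fin r) F) (WithZero (Multiplicative ℤ)) := by
  classical
  exact
  { toFun := fun p => if p = 0 then 0 else WithZero.exp (p.totalDegree : ℤ)
    map_zero' := by simp
    map_one' := by simp
    map_mul' := fun x y => by
      by_cases hx : x = 0
      · simp [hx]
      by_cases hy : y = 0
      · simp [hy]
      simp [hx, hy, MvPolynomial.totalDegree_mul_of_isDomain hx hy, WithZero.exp_add]
    map_add_le_max' := fun x y => by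
      by_cases hx : x = 0
      · simp [hx]
      by_cases hy : y = 0
      · simp [hy]
      by_cases hxy : x + y = 0
      · simp [hxy]
      simp only [hx, hy, hxy, if_false]
      rw [le_max_iff, WithZero.exp_le_exp, WithZero.exp_le_exp]
      have := MvPolynomial.totalDegree_add x y
      rw [le_max_iff] at this
      exact_mod_cast this }

theorem degVal_apply (F : Type*) [Field F] (r : ℕ) (p : MvPolynomial (Fin r) F) (hp : p ≠ 0) :
    degVal F r p = WithZero.exp (p.totalDegree : ℤ) := by
  classical
  exact if_neg hp

theorem degVal_C (F : Type*) [Field F] (r : ℕ) (c : F) :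
    degVal F r (MvPolynomial.C c) ≤ 1 := by
  by_cases hc : c = 0
  · simp [hc]
  rw [degVal_apply _ _ _ (by simpa using hc)]
  simp

theorem val_pid_aux {L : Type*} [Field L] (v : Valuation L (WithZero (Multiplicative ℤ))) :
    IsPrincipalIdealRing v.valuationSubring := by
  refine ⟨fun I => ?_⟩
  by_cases hI : I = ⊥
  · subst hI; exact bot_isPrincipal
  obtain ⟨x0, hx0, hx00⟩ := Submodule.exists_mem_ne_zero_of_ne_bot hI
  have key : ∃ x ∈ I, x ≠ 0 ∧ ∀ y ∈ I, v y ≤ v x := by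
    let S : Set ℕ := {m | ∃ x ∈ I, x ≠ 0 ∧ v (x : L) = WithZero.exp (-(m : ℤ))}
    have hv : ∀ x : v.valuationSubring, x ≠ 0 → ∃ m : ℕ, v (x : L) = WithZero.exp (-(m : ℤ)) := by
      intro x hx
      have hx1 : v (x : L) ≠ 0 := by
        rw [Valuation.ne_zero_iff]; exact fun h => hx (Subtype.ext h)
      have hx2 : v (x : L) ≤ 1 := x.2
      have h3 := WithZero.exp_log hx1
      have h4 : (v (x : L)).log ≤ 0 := by
        rw [← h3, ← WithZero.exp_zero, WithZero.exp_le_exp] at hx2; exact hx2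
      refine ⟨(-(v (x : L)).log).toNat, ?_⟩
      rw [Int.toNat_of_nonneg (by omega), neg_neg, h3]
    have hS : S.Nonempty := by
      obtain ⟨m, hm⟩ := hv x0 hx00
      exact ⟨m, x0, hx0, hx00, hm⟩
    obtain ⟨x, hx, hx0, hxm⟩ := Nat.sInf_mem hS
    refine ⟨x, hx, hx0, fun y hy => ?_⟩
    by_cases hy0 : y = 0
    · simp [hy0]
    obtain ⟨m, hm⟩ := hv y hy0
    rw [hxm, hm, WithZero.exp_le_exp]
    have : sInf S ≤ m := Nat.sInf_le ⟨y, hy, hy0, hm⟩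
    omega
  obtain ⟨x, hx, hx0, hmax⟩ := key
  refine ⟨x, le_antisymm (fun y hy => ?_) ?_⟩
  · have hxL : (x : L) ≠ 0 := fun h => hx0 (Subtype.ext h)
    rw [Submodule.mem_span_singleton]
    refine ⟨⟨y / x, ?_⟩, Subtype.ext ?_⟩
    · rw [Valuation.mem_valuationSubring_iff, map_div₀]
      exact div_le_one_of_le₀ (hmax y hy) zero_le
    · simp [hxL]
  · rw [Submodule.span_singleton_le_iff_mem]; exact hx
end Val1Sec

section Val2Sec
theorem oval_aux {A L E : Type*} [CommRing A] [IsDomain A] [IsPrincipalIdealRing A] [IsLocalRing A]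
    [Field L] [Field E] [Algebra A L] [IsFractionRing A L] [Algebra L E]
    [FiniteDimensional L E] [Algebra.IsSeparable L E] [Algebra A E] [IsScalarTower A L E] :
    IsPrincipalIdealRing (integralClosure A E) := by
  have := integralClosure.isDedekindDomain A L E
  have : FaithfulSMul A E := by
    rw [faithfulSMul_iff_algebraMap_injective, IsScalarTower.algebraMap_eq A L E]
    exact (algebraMap L E).injective.comp (IsFractionRing.injective A L)
  apply IsPrincipalIdealRing.of_finite_maximals
  refine (IsDedekindDomain.primesOver_finite (IsLocalRing.maximalIdeal A) (integralClosure A E)).subset ?_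
  intro I hI
  have hI : I.IsMaximal := hI
  refine ⟨hI.isPrime, ⟨?_⟩⟩
  have : (I.comap (algebraMap A (integralClosure A E))).IsMaximal :=
    Ideal.isMaximal_comap_of_isIntegral_of_isMaximal I
  exact (IsLocalRing.eq_maximalIdeal this).symm
end Val2Sec

section Val3Sec
theorem bound_aux {F L E : Type*} [Field F] (r : ℕ) [Field L] [Field E]
    [Algebra F L] [Algebra F E] [Algebra (MvPolynomial (Fin r) F) L] [IsFractionRing (MvPolynomial (Fin r) F) L]
    [Algebra (MvPolynomial (Fin r) F) E] [Algebra L E] [IsScalarTower (MvPolynomial (Fin r) F) L E]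
    [IsScalarTower F (MvPolynomial (Fin r) F) L] [IsScalarTower F L E]
    [FiniteDimensional L E] [Algebra.IsSeparable L E]
    (v : Valuation L (WithZero (Multiplicative ℤ)))
    (hv : ∀ p, v (algebraMap (MvPolynomial (Fin r) F) L p) = degVal F r p) (d : E) (hd : d ≠ 0) :
    ∃ W : Submodule F E, Module.Finite F W ∧ ∀ y : E, IsIntegral (MvPolynomial (Fin r) F) y →
      IsIntegral v.valuationSubring (d * y) → y ∈ W := by
  classical
  let P := MvPolynomial (Fin r) F
  let V := v.valuationSubring
  have halg : Algebra.IsAlgebraic V E := (IsFractionRing.comap_isAlgebraic_iff (A := V) (K := L) (C := E)).2 inferInstance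
  obtain ⟨s, b, hb⟩ := FiniteDimensional.exists_is_basis_integral P L E
  obtain ⟨e, he, hed⟩ := (halg.isAlgebraic d⁻¹).exists_integral_multiple
  choose δ hδ hδi using fun j : s => (halg.isAlgebraic (b j)).exists_integral_multiple
  let c : s → L := fun j => (e : L) * (δ j : L)
  have hc : ∀ j, c j ≠ 0 := fun j => mul_ne_zero (fun h => he (Subtype.ext h)) (fun h => hδ j (Subtype.ext h))
  let N : s → ℕ := fun j => (-(v (c j)).log).toNat
  let Wj : s → Submodule F L := fun j =>
    (MvPolynomial.restrictTotalDegree (Fin r) F (N j)).map (IsScalarTower.toAlgHom F P L).toLinearMap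
  have hWj : ∀ j, Module.Finite F (Wj j) := fun j => Module.Finite.map _ _
  let tr : s → (E →ₗ[F] L) := fun j => ((Algebra.traceForm L E).flip (b j)).restrictScalars F
  have htr : ∀ j y, tr j y = Algebra.trace L E (y * b j) := fun j y => rfl
  let W : Submodule F E := ⨅ j, (Wj j).comap (tr j)
  have hW : ∀ y, y ∈ W ↔ ∀ j, tr j y ∈ Wj j := fun y => by simp [W]
  refine ⟨W, ?_, ?_⟩
  · let Φ : W →ₗ[F] (∀ j, Wj j) := LinearMap.pi fun j =>
      ((tr j).comp W.subtype).codRestrict (Wj j) (fun y => (hW _).1 y.2 j)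
    refine Module.Finite.of_injective Φ ?_
    rw [injective_iff_map_eq_zero]
    intro y hy
    apply Subtype.ext
    refine (traceForm_nondegenerate L E).1 _ fun z => ?_
    have h0 : Algebra.traceForm L E (y : E) = 0 := by
      refine b.ext fun j => ?_
      have := congrArg Subtype.val (congrFun hy j)
      exact this
    rw [h0]; rfl
  · intro y hyP hyV
    rw [hW]
    intro j
    obtain ⟨p, hp⟩ := IsIntegrallyClosed.isIntegral_iff.1 (Algebra.isIntegral_trace (L := L) (hyP.mul (hb j)))
    refine ⟨p, ?_, hp⟩
    have h1 : IsIntegral V ((e • d⁻¹) * (d * y) * (δ j • b j)) := (hed.mul hyV).mul (hδi j)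
    have h2 : (e • d⁻¹) * (d * y) * (δ j • b j) = c j • (y * b j) := by
      have h3 : e • d⁻¹ = algebraMap L E e * d⁻¹ := by
        rw [Algebra.smul_def]; rfl
      have h4 : δ j • b j = algebraMap L E (δ j) * b j := by
        rw [Algebra.smul_def]; rfl
      rw [h3, h4, Algebra.smul_def]
      simp only [c, map_mul]
      field_simp
    rw [h2] at h1
    obtain ⟨q, hq⟩ := IsIntegrallyClosed.isIntegral_iff.1 (Algebra.isIntegral_trace (L := L) h1)
    have h5 : v (c j * algebraMap P L p) ≤ 1 := by
      rw [hp, ← smul_eq_mul, ← map_smul, ← hq]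
      exact q.2
    rw [map_mul, hv] at h5
    rw [SetLike.mem_coe, MvPolynomial.mem_restrictTotalDegree]
    by_cases hp0 : p = 0
    · simp [hp0]
    rw [degVal_apply _ _ _ hp0, ← WithZero.exp_log ((v.ne_zero_iff).2 (hc j)), ← WithZero.exp_add,
      ← WithZero.exp_zero, WithZero.exp_le_exp] at h5
    simp only [N]
    omega

theorem oring_aux (F F₂ : Type*) [Field F] [CharZero F] [Field F₂] [Algebra F F₂]
    [Algebra.EssFiniteType F F₂] (T : Set F₂) (hT : T.Finite) :
    ∃ O : Subring F₂, IsPrincipalIdealRing O ∧ IsFractionRing O F₂ ∧ (∀ c : F, algebraMap F F₂ c ∈ O) ∧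
      ∀ d : F₂, d ≠ 0 → ∃ W : Submodule F F₂, Module.Finite F W ∧
        ∀ y ∈ Algebra.adjoin F T, d * y ∈ O → y ∈ W := by
  obtain ⟨r, g, hg, hint, halg⟩ := noether_aux F F₂ T hT
  let P := MvPolynomial (Fin r) F
  letI : Algebra P F₂ := g.toRingHom.toAlgebra
  have hfaith : FaithfulSMul P F₂ := (faithfulSMul_iff_algebraMap_injective _ _).2 hg
  let L0 := FractionRing P
  letI : Algebra L0 F₂ := FractionRing.liftAlgebra P F₂
  have : IsScalarTower F P F₂ := IsScalarTower.of_algebraMap_eq fun x => (g.commutes x).symm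
  have : IsScalarTower F L0 F₂ := IsScalarTower.to₁₃₄ F P L0 F₂
  have : Algebra.IsAlgebraic L0 F₂ := (IsFractionRing.comap_isAlgebraic_iff (A := P) (K := L0) (C := F₂)).1 halg
  have : Algebra.EssFiniteType L0 F₂ := Algebra.EssFiniteType.of_comp F L0 F₂
  have : Module.Finite L0 F₂ := Algebra.finite_of_essFiniteType_of_isAlgebraic
  have : CharZero L0 := charZero_of_injective_algebraMap (algebraMap F L0).injective
  let v : Valuation L0 (WithZero (Multiplicative ℤ)) :=
    (degVal F r).extendToLocalization (S := P⁰) (fun p hp => by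
      have hp0 : p ≠ 0 := nonZeroDivisors.ne_zero hp
      change degVal F r p ≠ 0
      rw [degVal_apply _ _ _ hp0]; simp) L0
  have hv : ∀ p, v (algebraMap P L0 p) = degVal F r p := fun p =>
    Valuation.extendToLocalization_apply_map_apply _ _ _ _
  have := val_pid_aux v
  have hpid : IsPrincipalIdealRing (integralClosure v.valuationSubring F₂) := oval_aux (L := L0)
  have hfr : IsFractionRing (integralClosure v.valuationSubring F₂) F₂ :=
    integralClosure.isFractionRing_of_finite_extension L0 F₂
  refine ⟨(integralClosure v.valuationSubring F₂).toSubring, hpid, hfr, fun c => ?_, fun d hd => ?_⟩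
  · have hc : algebraMap P L0 (MvPolynomial.C c) ∈ v.valuationSubring := by
      rw [Valuation.mem_valuationSubring_iff, hv]; exact degVal_C F r c
    have : algebraMap F F₂ c = algebraMap v.valuationSubring F₂ ⟨_, hc⟩ := by
      change _ = algebraMap L0 F₂ (algebraMap P L0 (MvPolynomial.C c))
      rw [← IsScalarTower.algebraMap_apply P L0 F₂]
      exact (g.commutes c).symm
    rw [this]
    exact isIntegral_algebraMap
  · obtain ⟨W, hW, h⟩ := bound_aux r v hv d hd
    exact ⟨W, hW, fun y hy hdy => h y (hint y hy) hdy⟩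
end Val3Sec

section LauSec
section Lau
variable {F F₂ : Type*} [Field F] [Field F₂] [Algebra F F₂]

noncomputable def sigmaMap (F F₂ : Type*) [Field F] [Field F₂] [Algebra F F₂] :
    PowerSeries F ⊗[F] F₂ →ₐ[F] PowerSeries F₂ :=
  Algebra.TensorProduct.productMap (PowerSeries.mapAlgHom (Algebra.ofId F F₂))
    (IsScalarTower.toAlgHom F F₂ (PowerSeries F₂))

theorem sigma_tmul (c : PowerSeries F) (y : F₂) :
    sigmaMap F F₂ (c ⊗ₜ y) = PowerSeries.map (algebraMap F F₂) c * PowerSeries.C y := by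
  simp only [sigmaMap, Algebra.TensorProduct.productMap_apply_tmul]
  rfl

theorem sigma_coeff (c : PowerSeries F) (y : F₂) (i : ℕ) :
    PowerSeries.coeff i (sigmaMap F F₂ (c ⊗ₜ y)) = PowerSeries.coeff i c • y := by
  rw [sigma_tmul, PowerSeries.coeff_mul_C, PowerSeries.coeff_map, Algebra.smul_def]

theorem sigma_injective : Function.Injective (sigmaMap F F₂) := by
  rw [injective_iff_map_eq_zero]
  intro s hs
  let b := Module.Basis.ofVectorSpace F F₂
  let B := Algebra.TensorProduct.basis (PowerSeries F) b
  have h1 : s = (B.repr s).sum fun j c => c ⊗ₜ[F] b j := by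
    conv_lhs => rw [← B.linearCombination_repr s, Finsupp.linearCombination_apply]
    refine Finsupp.sum_congr fun j _ => ?_
    simp [B, Algebra.TensorProduct.basis_apply, TensorProduct.smul_tmul']
  have h2 : ∀ j, B.repr s j = 0 := by
    intro j
    ext i
    have h3 := congrArg (PowerSeries.coeff i) hs
    rw [h1, Finsupp.sum, map_sum, map_sum] at h3
    simp only [sigma_coeff, map_zero] at h3
    have h4 := linearIndependent_iff'.1 b.linearIndependent (B.repr s).support
      (fun j => PowerSeries.coeff i (B.repr s j)) h3 j
    by_cases hj : j ∈ (B.repr s).support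
    · simpa using h4 hj
    · rw [Finsupp.notMem_support_iff.1 hj]
  rw [h1, Finsupp.sum]
  exact Finset.sum_eq_zero fun j _ => by rw [h2]; simp

theorem sigma_fin (s : PowerSeries F ⊗[F] F₂) :
    ∃ T : Set F₂, T.Finite ∧ ∀ i, PowerSeries.coeff i (sigmaMap F F₂ s) ∈ Algebra.adjoin F T := by
  induction s with
  | zero => exact ⟨∅, Set.finite_empty, fun i => by simp⟩
  | tmul c y =>
    refine ⟨{y}, Set.finite_singleton y, fun i => ?_⟩
    rw [sigma_coeff]
    exact (Algebra.adjoin F {y}).smul_mem (Algebra.subset_adjoin (Set.mem_singleton y)) _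
  | add a b ha hb =>
    obtain ⟨Ta, ha, ha'⟩ := ha
    obtain ⟨Tb, hb, hb'⟩ := hb
    refine ⟨Ta ∪ Tb, ha.union hb, fun i => ?_⟩
    rw [map_add, map_add]
    exact add_mem (Algebra.adjoin_mono Set.subset_union_left (ha' i))
      (Algebra.adjoin_mono Set.subset_union_right (hb' i))

theorem sigma_surj (W : Submodule F F₂) [Module.Finite F W] (w : PowerSeries F₂)
    (hw : ∀ i, PowerSeries.coeff i w ∈ W) : ∃ s, sigmaMap F F₂ s = w := by
  let b := Module.finBasis F W
  refine ⟨∑ j, (PowerSeries.mk fun i => b.repr ⟨_, hw i⟩ j) ⊗ₜ (b j : F₂), ?_⟩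
  ext i
  rw [map_sum, map_sum]
  simp only [sigma_coeff, PowerSeries.coeff_mk]
  have := congrArg W.subtype (b.sum_repr ⟨_, hw i⟩)
  rw [map_sum] at this
  exact this

theorem clear_elt {E : Type*} [Field E] [Algebra (PowerSeries F) E] [IsFractionRing (PowerSeries F) E]
    (e : E) : ∃ (l : ℕ) (c : PowerSeries F),
    algebraMap (PowerSeries F) E (PowerSeries.X ^ l) * e = algebraMap (PowerSeries F) E c := by
  obtain ⟨a, b, hb, rfl⟩ := IsFractionRing.div_surjective (A := PowerSeries F) e
  have hb0 : b ≠ 0 := nonZeroDivisors.ne_zero hb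
  have h2 := PowerSeries.X_pow_order_mul_divXPowOrder (f := b)
  have h3 := PowerSeries.Inv_divided_by_X_pow_order_leftInv hb0
  have hbE : algebraMap (PowerSeries F) E b ≠ 0 := by
    rwa [Ne, map_eq_zero_iff _ (IsFractionRing.injective (PowerSeries F) E)]
  refine ⟨b.order.toNat, PowerSeries.Inv_divided_by_X_pow_order hb0 * a, ?_⟩
  rw [mul_div_assoc', div_eq_iff hbE, ← map_mul, ← map_mul]
  congr 1
  linear_combination (-PowerSeries.X ^ b.order.toNat * a) * h3 +
    (PowerSeries.Inv_divided_by_X_pow_order hb0 * a) * h2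

variable {E Λ : Type*} [Field E] [Field Λ] [Algebra F E] [Algebra F Λ]
  [Algebra (PowerSeries F) E] [IsFractionRing (PowerSeries F) E] [IsScalarTower F (PowerSeries F) E]
  [Algebra (PowerSeries F₂) Λ] [IsFractionRing (PowerSeries F₂) Λ] [IsScalarTower F (PowerSeries F₂) Λ]

theorem clear_tensor (z : E ⊗[F] F₂) : ∃ (l : ℕ) (s : PowerSeries F ⊗[F] F₂),
    (algebraMap (PowerSeries F) E (PowerSeries.X ^ l) ⊗ₜ 1) * z =
      Algebra.TensorProduct.map (IsScalarTower.toAlgHom F (PowerSeries F) E) (AlgHom.id F F₂) s := by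
  induction z with
  | zero => exact ⟨0, 0, by simp⟩
  | tmul e y =>
    obtain ⟨l, c, h⟩ := clear_elt (F := F) e
    refine ⟨l, c ⊗ₜ y, ?_⟩
    rw [Algebra.TensorProduct.tmul_mul_tmul, h, Algebra.TensorProduct.map_tmul, one_mul]
    rfl
  | add a b ha hb =>
    obtain ⟨l, s, h⟩ := ha
    obtain ⟨l', s', h'⟩ := hb
    refine ⟨l + l', ((PowerSeries.X ^ l') ⊗ₜ 1) * s + ((PowerSeries.X ^ l) ⊗ₜ 1) * s', ?_⟩
    rw [map_add, map_mul, map_mul, ← h, ← h', Algebra.TensorProduct.map_tmul, Algebra.TensorProduct.map_tmul,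
      IsScalarTower.coe_toAlgHom', AlgHom.id_apply, mul_add, ← mul_assoc, ← mul_assoc,
      Algebra.TensorProduct.tmul_mul_tmul, Algebra.TensorProduct.tmul_mul_tmul, ← map_mul, ← map_mul,
      ← pow_add, ← pow_add, one_mul, add_comm l' l]

theorem theta_aux (F F₂ E Λ : Type*) [Field F] [Field F₂] [Algebra F F₂] [Field E] [Field Λ] [Algebra F E] [Algebra F Λ]
    [Algebra (PowerSeries F) E] [IsFractionRing (PowerSeries F) E] [IsScalarTower F (PowerSeries F) E]
    [Algebra (PowerSeries F₂) Λ] [IsFractionRing (PowerSeries F₂) Λ] [IsScalarTower F (PowerSeries F₂) Λ] :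
    ∃ Θ : E ⊗[F] F₂ →ₐ[F] Λ, Function.Injective Θ ∧ ∀ s : PowerSeries F ⊗[F] F₂,
      Θ (Algebra.TensorProduct.map (IsScalarTower.toAlgHom F (PowerSeries F) E) (AlgHom.id F F₂) s) =
        algebraMap (PowerSeries F₂) Λ (sigmaMap F F₂ s) := by
  let m : PowerSeries F →+* Λ := (algebraMap (PowerSeries F₂) Λ).comp (PowerSeries.map (algebraMap F F₂))
  have hm : Function.Injective m :=
    (IsFractionRing.injective (PowerSeries F₂) Λ).comp
      (PowerSeries.map_injective _ (algebraMap F F₂).injective)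
  let ε : E →+* Λ := IsFractionRing.lift (A := PowerSeries F) (g := m) hm
  have hε : ∀ c, ε (algebraMap (PowerSeries F) E c) = m c := fun c => IsFractionRing.lift_algebraMap hm c
  let ε' : E →ₐ[F] Λ := ⟨ε, fun x => by
    change ε (algebraMap F E x) = _
    rw [IsScalarTower.algebraMap_apply F (PowerSeries F) E, hε,
      IsScalarTower.algebraMap_apply F (PowerSeries F₂) Λ]
    change algebraMap (PowerSeries F₂) Λ (PowerSeries.map (algebraMap F F₂) (PowerSeries.C x)) = _
    rw [PowerSeries.map_C, PowerSeries.algebraMap_apply]⟩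
  let κ : F₂ →ₐ[F] Λ := (IsScalarTower.toAlgHom F (PowerSeries F₂) Λ).comp
    (IsScalarTower.toAlgHom F F₂ (PowerSeries F₂))
  let Θ : E ⊗[F] F₂ →ₐ[F] Λ := Algebra.TensorProduct.productMap ε' κ
  have hΘ : ∀ s : PowerSeries F ⊗[F] F₂,
      Θ (Algebra.TensorProduct.map (IsScalarTower.toAlgHom F (PowerSeries F) E) (AlgHom.id F F₂) s) =
        algebraMap (PowerSeries F₂) Λ (sigmaMap F F₂ s) := by
    intro s
    induction s with
    | zero => simp
    | tmul c y =>
      rw [Algebra.TensorProduct.map_tmul, sigma_tmul, map_mul]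
      change ε' _ * κ _ = _
      congr 1
      exact hε c
    | add a b ha hb => simp only [map_add, ha, hb]
  refine ⟨Θ, ?_, hΘ⟩
  rw [injective_iff_map_eq_zero]
  intro z hz
  obtain ⟨l, s, h⟩ := clear_tensor z
  have h1 := congrArg Θ h
  rw [map_mul, hz, mul_zero, hΘ, eq_comm, map_eq_zero_iff _ (IsFractionRing.injective (PowerSeries F₂) Λ),
    map_eq_zero_iff _ sigma_injective] at h1
  rw [h1, map_zero] at h
  have hX : algebraMap (PowerSeries F) E (PowerSeries.X ^ l) ≠ 0 := by
    rw [Ne, map_eq_zero_iff _ (IsFractionRing.injective (PowerSeries F) E)]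
    exact pow_ne_zero _ PowerSeries.X_ne_zero
  have h2 := congrArg (fun t => ((algebraMap (PowerSeries F) E (PowerSeries.X ^ l))⁻¹ ⊗ₜ[F] (1 : F₂)) * t) h
  simp only [mul_zero] at h2
  rwa [← mul_assoc, Algebra.TensorProduct.tmul_mul_tmul, inv_mul_cancel₀ hX, one_mul,
    ← Algebra.TensorProduct.one_def, one_mul] at h2
end Lau
end LauSec

section MainSec
theorem sigma_bdd_aux (F F₂ Λ : Type*) [Field F] [Field F₂] [Algebra F F₂] [Field Λ]
    (φ : PowerSeries F₂ →+* Λ) (O : Subring F₂) [IsFractionRing O F₂]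
    (hO : ∀ c : F, algebraMap F F₂ c ∈ O) (s : PowerSeries F ⊗[F] F₂) :
    φ (sigmaMap F F₂ s) ∈ bddSubring φ O := by
  induction s with
  | zero => rw [map_zero, map_zero]; exact zero_mem _
  | add a b ha hb => rw [map_add, map_add]; exact add_mem ha hb
  | tmul c y =>
    obtain ⟨a, d, hd, rfl⟩ := IsFractionRing.div_surjective (A := O) y
    have hd0 : d ≠ 0 := nonZeroDivisors.ne_zero hd
    let h : F →+* O := (algebraMap F F₂).codRestrict O hO
    refine ⟨d, 0, PowerSeries.map h c * PowerSeries.C a, hd0, ?_⟩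
    rw [← map_mul, sigma_tmul]
    congr 1
    have h1 : PowerSeries.map (algebraMap O F₂) (PowerSeries.map h c) = PowerSeries.map (algebraMap F F₂) c := by
      ext i; rfl
    rw [pow_zero, mul_one, map_mul, PowerSeries.map_C, PowerSeries.map_C, h1]
    have h2 : PowerSeries.C ((algebraMap O F₂) d) * PowerSeries.C (algebraMap O F₂ a / algebraMap O F₂ d) =
        PowerSeries.C (algebraMap O F₂ a) := by
      rw [← map_mul]
      congr 1
      have : algebraMap O F₂ d ≠ 0 := by
        rwa [Ne, map_eq_zero_iff _ (IsFractionRing.injective O F₂)]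
      field_simp
    rw [← h2]; ring

theorem bdd_div_aux {Q Λ : Type*} [Field Q] [Field Λ] (φ : PowerSeries Q →+* Λ) (O : Type*) [CommRing O]
    [IsDomain O] [Algebra O Q] [FaithfulSMul O Q] (x : Λ) (l : ℕ)
    (h : φ (PowerSeries.X ^ l) * x ∈ bddSubring φ O) : x ∈ bddSubring φ O := by
  obtain ⟨d, k, y, hd, h⟩ := h
  refine ⟨d, k + l, y, hd, ?_⟩
  rw [← h, pow_add, ← mul_assoc, map_mul (PowerSeries.map _) (_ * _), map_mul φ, mul_assoc, map_pow, PowerSeries.map_X]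

theorem fprime_aux (F F₂ : Type*) [Field F] [CharZero F] [Field F₂] [Algebra F F₂] (T : Set F₂) (hT : T.Finite)
    (n : ℕ) (hn : 1 ≤ n) (p : PowerSeries F₂) (hp : p ≠ 0)
    (hpT : ∀ i, PowerSeries.coeff i p ∈ Algebra.adjoin F T) :
    ∃ (T' : Set F₂) (k : ℕ) (f0 : F₂) (w : PowerSeries F₂), T'.Finite ∧ f0 ≠ 0 ∧
      PowerSeries.constantCoeff w = 1 ∧ p = PowerSeries.X ^ k * PowerSeries.C f0 * w ^ n ∧
      ∀ i, PowerSeries.coeff i w ∈ Algebra.adjoin F T' := by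
  let k := p.order.toNat
  let h := p.divXPowOrder
  have hph : PowerSeries.X ^ k * h = p := PowerSeries.X_pow_order_mul_divXPowOrder
  let f0 := PowerSeries.constantCoeff h
  have hf0 : f0 ≠ 0 := by
    intro h0
    exact hp (PowerSeries.constantCoeff_divXPowOrder_eq_zero_iff.1 h0)
  let T' := insert f0⁻¹ T
  let R := Algebra.adjoin F T'
  have hTR : Algebra.adjoin F T ≤ R := Algebra.adjoin_mono (Set.subset_insert _ _)
  have hfR : f0⁻¹ ∈ R := Algebra.subset_adjoin (Set.mem_insert _ _)
  have hh : ∀ i, PowerSeries.coeff i h ∈ R := by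
    intro i
    have : PowerSeries.coeff (i + k) p = PowerSeries.coeff i h := by
      rw [← hph, PowerSeries.coeff_X_pow_mul]
    rw [← this]
    exact hTR (hpT _)
  letI : Algebra ℚ R := ((algebraMap F R).comp (algebraMap ℚ F)).toAlgebra
  let q : PowerSeries R := PowerSeries.mk fun i => ⟨f0⁻¹ * PowerSeries.coeff i h, mul_mem hfR (hh i)⟩
  have hq0 : PowerSeries.constantCoeff q = 1 := by
    rw [← PowerSeries.coeff_zero_eq_constantCoeff_apply, PowerSeries.coeff_mk]
    apply Subtype.ext
    change f0⁻¹ * PowerSeries.coeff 0 h = 1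
    rw [PowerSeries.coeff_zero_eq_constantCoeff_apply]
    exact inv_mul_cancel₀ hf0
  obtain ⟨w, hw, hw0⟩ := nth_root_aux n hn q hq0
  refine ⟨T', k, f0, PowerSeries.map R.val.toRingHom w, hT.insert _, hf0, ?_, ?_, fun i => ?_⟩
  · rw [← PowerSeries.coeff_zero_eq_constantCoeff_apply, PowerSeries.coeff_map,
      PowerSeries.coeff_zero_eq_constantCoeff_apply, hw0, map_one]
  · rw [← map_pow, hw, mul_assoc, ← hph]
    congr 1
    ext i
    rw [PowerSeries.coeff_C_mul, PowerSeries.coeff_map, PowerSeries.coeff_mk]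
    change _ = f0 * (f0⁻¹ * PowerSeries.coeff i h)
    rw [mul_inv_cancel_left₀ hf0]
  · rw [PowerSeries.coeff_map]
    exact (PowerSeries.coeff i w).2

theorem main_aux (F F₂ K0 : Type*) [Field F] [IsAlgClosed F] [CharZero F] [Field F₂] [Algebra F F₂]
    [Algebra.EssFiniteType F F₂] [Field K0] [Algebra F K0] [Algebra.EssFiniteType F K0]
    (n : ℕ) (hn : 1 ≤ n) (I : Ideal (K0 ⊗[F] F₂)) (f : K0 ⊗[F] F₂) (hf : f ≠ 0)
    (hI : I ^ n = Ideal.span {f}) :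
    ∃ (w : K0 ⊗[F] F₂) (e : K0) (g : F₂), e ≠ 0 ∧ g ≠ 0 ∧ w ^ n = (e ⊗ₜ g) * f := by
  let E := FractionRing (PowerSeries F)
  let Λ := FractionRing (PowerSeries F₂)
  have hjE : Function.Injective (algebraMap (PowerSeries F) E) := IsFractionRing.injective _ _
  have hjΛ : Function.Injective (algebraMap (PowerSeries F₂) Λ) := IsFractionRing.injective _ _
  let φ := algebraMap (PowerSeries F₂) Λ
  obtain ⟨ψ, hψ⟩ := embed_aux F K0 E (algebraMap (PowerSeries F) E) hjE
  have hψ' : ∀ x, ψ (algebraMap F K0 x) = algebraMap F E x := fun x => by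
    rw [hψ, IsScalarTower.algebraMap_apply F (PowerSeries F) E]; rfl
  let ψ' : K0 →ₐ[F] E := ⟨ψ, hψ'⟩
  let Ψ := Algebra.TensorProduct.map ψ' (AlgHom.id F F₂)
  have hΨ : Function.Injective Ψ := bc_inj_aux ψ' ψ'.toRingHom.injective
  obtain ⟨Θ, hΘinj, hΘ⟩ := theta_aux F F₂ E Λ
  let j : K0 ⊗[F] F₂ →+* Λ := Θ.toRingHom.comp Ψ.toRingHom
  have hj : ∀ a, j a = Θ (Ψ a) := fun a => rfl
  have hXl : ∀ l : ℕ, Θ (algebraMap (PowerSeries F) E (PowerSeries.X ^ l) ⊗ₜ 1) = φ (PowerSeries.X ^ l) := by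
    intro l
    have h1 := hΘ ((PowerSeries.X ^ l) ⊗ₜ 1)
    rw [Algebra.TensorProduct.map_tmul, sigma_tmul, map_pow (PowerSeries.map _), PowerSeries.map_X, map_one PowerSeries.C,
      mul_one] at h1
    exact h1
  have hclear : ∀ z : E ⊗[F] F₂, ∃ (l : ℕ) (s : PowerSeries F ⊗[F] F₂),
      φ (PowerSeries.X ^ l) * Θ z = φ (sigmaMap F F₂ s) := by
    intro z
    obtain ⟨l, s, h⟩ := clear_tensor z
    refine ⟨l, s, ?_⟩
    have := congrArg Θ h
    rwa [map_mul, hXl, hΘ] at this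
  obtain ⟨l, s, hls⟩ := hclear (Ψ f)
  have hX0 : ∀ l : ℕ, φ (PowerSeries.X ^ l) ≠ 0 := fun l => by
    rw [Ne, map_eq_zero_iff _ hjΛ]
    exact pow_ne_zero _ PowerSeries.X_ne_zero
  have hs0 : sigmaMap F F₂ s ≠ 0 := by
    intro h0
    rw [h0, map_zero, mul_eq_zero, map_eq_zero_iff _ hΘinj, map_eq_zero_iff _ hΨ] at hls
    exact hls.elim (hX0 l) hf
  obtain ⟨T, hT, hsT⟩ := sigma_fin s
  obtain ⟨T', k, f0, w, hT', hf0, hw0, hpw, hwT⟩ := fprime_aux F F₂ T hT n hn _ hs0 hsT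
  obtain ⟨O, hpid, hfr, hFO, hOW⟩ := oring_aux F F₂ T' hT'
  have hjb : ∀ a, j a ∈ bddSubring φ O := by
    intro a
    obtain ⟨l, s, h⟩ := hclear (Ψ a)
    apply bdd_div_aux φ O _ l
    rw [hj, h]
    exact sigma_bdd_aux F F₂ Λ φ O hFO s
  letI : Algebra ℚ O := (((algebraMap F F₂).codRestrict O hFO).comp (algebraMap ℚ F)).toAlgebra
  have : CharZero F₂ := charZero_of_injective_algebraMap (algebraMap F F₂).injective
  obtain ⟨d, hd, hdw⟩ := core_aux φ hjΛ j hjb n hn f I hI k l f0 hf0 w hw0 (by rw [hj, hls, hpw])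
  obtain ⟨W, hWfin, hW⟩ := hOW (d : F₂) (fun h => hd (Subtype.ext h))
  obtain ⟨s', hs'⟩ := sigma_surj W w (fun i => hW _ (hwT i) (by
    obtain ⟨y, hy⟩ := hdw i
    have hy' : (d : F₂) * PowerSeries.coeff i w = y := hy
    rw [hy']; exact y.2))
  let x : ℕ → E := fun l => algebraMap (PowerSeries F) E (PowerSeries.X ^ l)
  have hx : ∀ l, x l ≠ 0 := fun l => by
    simp only [x]
    rw [Ne, map_eq_zero_iff _ hjE]
    exact pow_ne_zero _ PowerSeries.X_ne_zero
  let wE := Algebra.TensorProduct.map (IsScalarTower.toAlgHom F (PowerSeries F) E) (AlgHom.id F F₂) s'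
  have hwE : Θ wE = φ w := by rw [hΘ, hs']
  have hC : Θ (x k ⊗ₜ f0) = φ (PowerSeries.X ^ k * PowerSeries.C f0) := by
    have h1 := hΘ ((PowerSeries.X ^ k) ⊗ₜ f0)
    rw [Algebra.TensorProduct.map_tmul, sigma_tmul, map_pow (PowerSeries.map _), PowerSeries.map_X] at h1
    exact h1
  have key : (x k ⊗ₜ[F] f0) * wE ^ n = (x l ⊗ₜ[F] (1 : F₂)) * Ψ f := by
    apply hΘinj
    rw [map_mul, map_mul, map_pow, hwE, hC, hXl, hls, hpw, ← map_pow, ← map_mul]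
  have key2 : wE ^ n = ((x l * (x k)⁻¹) ⊗ₜ[F] f0⁻¹) * Ψ f := by
    have h1 := congrArg (fun t => ((x k)⁻¹ ⊗ₜ[F] f0⁻¹) * t) key
    simp only [← mul_assoc, Algebra.TensorProduct.tmul_mul_tmul] at h1
    rw [inv_mul_cancel₀ (hx k), inv_mul_cancel₀ hf0, ← Algebra.TensorProduct.one_def, one_mul, mul_one] at h1
    rw [h1, mul_comm (x l)]
  obtain ⟨w', e, he, h⟩ := solve_aux ψ hψ' f hf n hn wE _ (mul_ne_zero (hx l) (inv_ne_zero (hx k)))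
    f0⁻¹ (inv_ne_zero hf0) key2
  exact ⟨w', e, f0⁻¹, he, inv_ne_zero hf0, h⟩
end MainSec

/-- Let `F` be an algebraically closed field of characteristic `0`, `F₂` a finitely generated
field extension of `F`, and `K` an arbitrary field extension of `F`.  Then the Picard group of
`K ⊗[F] F₂` is torsion free: if `M` is an invertible `K ⊗[F] F₂`-module (with inverse
witnessed by a module `N`) whose `n`-fold tensor power is free for some `n ≥ 1`, then `M` is
free. -/
theorem pic_of_tensorProduct_torsionFree
    (F F₂ K : Type*) [Field F] [IsAlgClosed F] [CharZero F] [Field F₂] [Algebra F F₂]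
    [Field K] [Algebra F K]
    (hfg₂ : (⊤ : IntermediateField F F₂).FG)
    (M : Type*) [AddCommGroup M] [Module (K ⊗[F] F₂) M]
    (N : Type*) [AddCommGroup N] [Module (K ⊗[F] F₂) N]
    (hinv : Nonempty (TensorProduct (K ⊗[F] F₂) M N ≃ₗ[K ⊗[F] F₂] (K ⊗[F] F₂)))
    (n : ℕ) (hn : 1 ≤ n)
    (hfree : Module.Free (K ⊗[F] F₂)
      (PiTensorProduct (K ⊗[F] F₂) (fun _ : Fin n => M))) :
    Module.Free (K ⊗[F] F₂) M := by
  have h0 : Algebra.EssFiniteType F F₂ := by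
    rw [← Algebra.EssFiniteType.iff_of_algEquiv (IntermediateField.topEquiv (F := F) (E := F₂))]
    exact IntermediateField.essFiniteType_iff.2 hfg₂
  have hdom := isDomain_tensor_aux F F₂ K
  have hic := isIntegrallyClosed_tensor_aux F F₂ K
  refine pic_red_aux (K ⊗[F] F₂) M N hinv n hfree fun I f hIfg hf hI => ?_
  obtain ⟨K0, I0, f0, hK0, hf0, hmap, hI0⟩ := descend_aux F F₂ K n I f hIfg hf hI
  have h1 : Algebra.EssFiniteType F K0 := IntermediateField.essFiniteType_iff.2 hK0
  obtain ⟨w, e, g, he, hg, hw⟩ := main_aux F F₂ K0 n hn I0 f0 hf0 hI0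
  let Φ := Algebra.TensorProduct.map K0.val (AlgHom.id F F₂)
  have hw' : Φ w ^ n = ((e : K) ⊗ₜ[F] g) * f := by
    have := congrArg Φ hw
    rw [map_pow, map_mul] at this
    rw [this, ← hmap]
    rfl
  have hu : IsUnit ((e : K) ⊗ₜ[F] g) := by
    have heK : (e : K) ≠ 0 := fun h => he (Subtype.ext h)
    refine IsUnit.of_mul_eq_one ((e : K)⁻¹ ⊗ₜ[F] g⁻¹) ?_
    rw [Algebra.TensorProduct.tmul_mul_tmul, mul_inv_cancel₀ heK, mul_inv_cancel₀ hg, Algebra.TensorProduct.one_def]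
  exact ⟨Φ w, principal_aux n hn I f (Φ w) _ hu hf hI hw'⟩
end

section
/- Let K be a field of characteristic 0, and let D₁ and D₂ be division rings that are finite-dimensional K-algebras. Suppose there is a field L which is a nontrivial finite extension of K (so K ⊊ L) admitting K-algebra embeddings L → D₁ and L → D₂. Then D₁ ⊗_K D₂ has zero divisors; in particular D₁ ⊗_K D₂ is not a division ring. -/
open scoped TensorProduct

/-- Let `K` be a field of characteristic `0` and `D₁, D₂` division rings which are
finite-dimensional `K`-algebras.  Suppose some field `L`, a nontrivial finite extension of
`K`, admits `K`-algebra embeddings into both `D₁` and `D₂`.  Then `D₁ ⊗[K] D₂` has zero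
divisors; in particular it is not a division ring. -/
theorem tensorProduct_has_zero_divisor_of_common_subfield
    (K : Type*) [Field K] [CharZero K]
    (D₁ D₂ : Type*) [DivisionRing D₁] [DivisionRing D₂]
    [Algebra K D₁] [Algebra K D₂] [FiniteDimensional K D₁] [FiniteDimensional K D₂]
    (L : Type*) [Field L] [Algebra K L] [FiniteDimensional K L]
    (hL : 1 < Module.finrank K L)
    (f₁ : L →ₐ[K] D₁) (f₂ : L →ₐ[K] D₂) :
    (∃ α β : D₁ ⊗[K] D₂, α ≠ 0 ∧ β ≠ 0 ∧ α * β = 0) ∧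
      ¬ (∀ x : D₁ ⊗[K] D₂, x ≠ 0 → IsUnit x) := by
  have key : ∃ x y : L ⊗[K] L, x ≠ 0 ∧ y ≠ 0 ∧ x * y = 0 := by
    let m : L ⊗[K] L →ₐ[K] L := Algebra.TensorProduct.lmul' K
    have hm : ¬ Function.Injective m := by
      intro h
      have h1 := LinearMap.finrank_le_finrank_of_injective (f := m.toLinearMap) h
      rw [Module.finrank_tensorProduct] at h1
      nlinarith
    obtain ⟨x, hx, hx0⟩ : ∃ x, m x = 0 ∧ x ≠ 0 := by
      by_contra! h
      exact hm ((injective_iff_map_eq_zero m).2 h)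
    have hu : ¬ IsUnit x := fun h => by
      have := h.map m
      rw [hx] at this
      exact not_isUnit_zero this
    haveI : IsArtinianRing (L ⊗[K] L) := IsArtinianRing.of_finite K _
    have hnz : x ∉ nonZeroDivisors (L ⊗[K] L) := fun h =>
      hu (IsArtinianRing.isUnit_of_mem_nonZeroDivisors h)
    rw [mem_nonZeroDivisors_iff_right] at hnz
    push Not at hnz
    obtain ⟨y, hy, hy0⟩ := hnz
    exact ⟨y, x, hy0, hx0, hy⟩
  have hinj : Function.Injective (Algebra.TensorProduct.map f₁ f₂) :=
    TensorProduct.map_injective_of_flat_flat f₁.toLinearMap f₂.toLinearMap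
      f₁.toRingHom.injective f₂.toRingHom.injective
  obtain ⟨x, y, hx, hy, hxy⟩ := key
  have main : ∃ α β : D₁ ⊗[K] D₂, α ≠ 0 ∧ β ≠ 0 ∧ α * β = 0 :=
    ⟨Algebra.TensorProduct.map f₁ f₂ x, Algebra.TensorProduct.map f₁ f₂ y,
      (map_ne_zero_iff _ hinj).2 hx, (map_ne_zero_iff _ hinj).2 hy,
      by rw [← map_mul, hxy, map_zero]⟩
  refine ⟨main, fun h => ?_⟩
  obtain ⟨α, β, hα, hβ, hαβ⟩ := main
  exact hβ ((h α hα).mul_right_eq_zero.1 hαβ)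
end
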